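/- arXiv:2103.01709 — 8 statements merged into one kernel-verified Lean document; each statement's English description precedes it below -/
import Mathlib

section
/- Let Λ be a finite set of sites, each site carrying the finite alphabet Fin d, and let the classical Hamiltonian be H(s) = ∑_{i∈I} h_i(s) on configurations s ∈ ∏_{x∈Λ} Fin d, where each h_i : (∏_{x∈Λ} Fin d) → ℝ depends only on the coordinates in a set supp(h_i) ⊆ Λ. Let A ⊆ Λ, B = Λ∖A, ∂A = {x ∈ A : ∃ i, x ∈ supp(h_i) and supp(h_i) ∩ B ≠ ∅}, and ∂B defined symmetrically. Let P(s) = e^{−βH(s)} / ∑_{s'} e^{−βH(s')} be the Gibbs distribution with β > 0, and let P_A, P_B be its marginals on the A- and B-coordinates. Then for every α ∈ (0,1) ∪ (1,2], D_α(P ‖ P_A ⊗ P_B) ≤ (|∂A| + |∂B|)·log d. -/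
open Classical

/-- Classical Rényi divergence `D_α(P‖Q) = (α−1)⁻¹ log ∑_x P(x)^α Q(x)^{1−α}`
(real powers, with the `rpow` convention `0^t = 0` for `t ≠ 0`). -/
noncomputable def renyiDiv {X : Type*} [Fintype X] (α : ℝ) (P Q : X → ℝ) : ℝ :=
  (α - 1)⁻¹ * Real.log (∑ x, P x ^ α * Q x ^ (1 - α))

/-- Every Rényi divergence of order `α ≤ 2` is at most the one of order `2`. -/
lemma renyiDiv_le_log_sum_sq_div {X : Type*} [Fintype X] {P Q : X → ℝ}
    (hP : ∀ x, 0 < P x) (hQ : ∀ x, 0 < Q x) (hsum : ∑ x, P x = 1)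
    {α : ℝ} (hα : α ∈ Set.Ioo (0:ℝ) 1 ∪ Set.Ioc 1 2) :
    renyiDiv α P Q ≤ Real.log (∑ x, P x ^ 2 / Q x) := by
  have hne : (Finset.univ : Finset X).Nonempty := by
    by_contra hempty
    simp [Finset.not_nonempty_iff_eq_empty.mp hempty] at hsum
  have hterm : ∀ x, P x ^ α * Q x ^ (1 - α) = P x * (P x / Q x) ^ (α - 1) := by
    intro x
    rw [Real.div_rpow (hP x).le (hQ x).le, Real.rpow_sub_one (hP x).ne',
      show α - 1 = -(1 - α) by ring, Real.rpow_neg (hQ x).le]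
    have := (hP x).ne'
    have := (Real.rpow_pos_of_pos (hQ x) (1 - α)).ne'
    field_simp
  have hsq : ∑ x, P x ^ 2 / Q x = ∑ x, P x * (P x / Q x) :=
    Finset.sum_congr rfl fun x _ => by ring
  have hr : ∀ x, 0 < P x / Q x := fun x => div_pos (hP x) (hQ x)
  have hpos : 0 < ∑ x, P x * (P x / Q x) :=
    Finset.sum_pos (fun x _ => mul_pos (hP x) (hr x)) hne
  have hpos' : 0 < ∑ x, P x * (P x / Q x) ^ (α - 1) :=
    Finset.sum_pos (fun x _ => mul_pos (hP x) (Real.rpow_pos_of_pos (hr x) _)) hne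
  unfold renyiDiv
  simp_rw [hterm]
  rw [hsq]
  rcases hα with ⟨_, h1⟩ | ⟨h1, h2⟩
  · have hJ : ∀ f : X → ℝ, (∀ x, 0 < f x) →
        ∑ x, P x * Real.log (f x) ≤ Real.log (∑ x, P x * f x) := fun f hf =>
      strictConcaveOn_log_Ioi.concaveOn.le_map_sum (t := Finset.univ)
        (fun x _ => (hP x).le) hsum (fun x _ => hf x)
    have hpow := hJ _ fun x => Real.rpow_pos_of_pos (hr x) (α - 1)
    simp_rw [Real.log_rpow (hr _), mul_left_comm _ (α - 1)] at hpow
    rw [← Finset.mul_sum] at hpow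
    rw [inv_mul_eq_div, div_le_iff_of_neg (by linarith), mul_comm]
    exact (mul_le_mul_of_nonpos_left (hJ _ hr) (by linarith)).trans hpow
  · have hJ := (Real.concaveOn_rpow (p := α - 1) (by linarith) (by linarith)).le_map_sum
      (t := Finset.univ) (w := P) (p := fun x => P x / Q x)
      (fun x _ => (hP x).le) hsum (fun x _ => (hr x).le)
    simp only [smul_eq_mul] at hJ
    have hlog := Real.log_le_log hpos' hJ
    rw [Real.log_rpow hpos] at hlog
    rwa [inv_mul_le_iff₀ (by linarith)]

/-- If the conditional law of the second variable given the first one, `x`, depends on `x` only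
through `π x ∈ S`, then the exponential of the order-two mutual information is at most `|S|`. -/
lemma sum_sq_div_marginals_le_card {X Y S : Type*} [Fintype X] [Fintype Y] [Fintype S]
    [Nonempty Y] [Nonempty X] {P : X → Y → ℝ} (hP : ∀ x y, 0 < P x y) (π : X → S) (e : S → X)
    (hcross : ∀ x y y', P x y * P (e (π x)) y' = P x y' * P (e (π x)) y) :
    ∑ x, ∑ y, P x y ^ 2 / ((∑ y', P x y') * ∑ x', P x' y) ≤ Fintype.card S := by
  have hA : ∀ x, 0 < ∑ y, P x y := fun x =>
    Finset.sum_pos (fun y _ => hP x y) Finset.univ_nonempty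
  have hB : ∀ y, 0 < ∑ x, P x y := fun y =>
    Finset.sum_pos (fun x _ => hP x y) Finset.univ_nonempty
  have hcond : ∀ x y, P x y / ∑ y', P x y' ≤ ∑ s, P (e s) y / ∑ y', P (e s) y' := by
    intro x y
    have heq : P x y / ∑ y', P x y' = P (e (π x)) y / ∑ y', P (e (π x)) y' := by
      rw [div_eq_div_iff (hA _).ne' (hA _).ne', Finset.mul_sum, Finset.mul_sum]
      exact Finset.sum_congr rfl fun y' _ => by rw [hcross, mul_comm]
    rw [heq]
    exact Finset.single_le_sum (f := fun s => P (e s) y / ∑ y', P (e s) y')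
      (fun s _ => (div_pos (hP _ _) (hA _)).le) (Finset.mem_univ (π x))
  calc ∑ x, ∑ y, P x y ^ 2 / ((∑ y', P x y') * ∑ x', P x' y)
      = ∑ y, ∑ x, (P x y / ∑ x', P x' y) * (P x y / ∑ y', P x y') := by
        rw [Finset.sum_comm]
        refine Finset.sum_congr rfl fun y _ => Finset.sum_congr rfl fun x _ => ?_
        rw [div_mul_div_comm, sq, mul_comm (∑ y', P x y')]
    _ ≤ ∑ y, ∑ x, (P x y / ∑ x', P x' y) * ∑ s, P (e s) y / ∑ y', P (e s) y' :=
        Finset.sum_le_sum fun y _ => Finset.sum_le_sum fun x _ =>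
          mul_le_mul_of_nonneg_left (hcond x y) (div_pos (hP _ _) (hB _)).le
    _ = ∑ y, ∑ s, P (e s) y / ∑ y', P (e s) y' := by
        refine Finset.sum_congr rfl fun y _ => ?_
        rw [← Finset.sum_mul, ← Finset.sum_div, div_self (hB y).ne', one_mul]
    _ = Fintype.card S := by
        rw [Finset.sum_comm]
        simp [← Finset.sum_div, div_self (hA _).ne']

/-- A Hamiltonian whose terms meeting both sides of the cut only see the sites of `C` inside `A`
splits additively between configurations on `A` agreeing on `C`. -/
lemma energy_exchange {Λ I V : Type*} [DecidableEq Λ] [Fintype I] {h : I → (Λ → V) → ℝ} {supp : I → Finset Λ}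
    (hdep : ∀ i, ∀ s t : Λ → V, (∀ x ∈ supp i, s x = t x) → h i s = h i t)
    {A C : Finset Λ} (hC : ∀ i, ∀ x ∈ supp i, x ∈ A → (∃ y ∈ supp i, y ∉ A) → x ∈ C)
    {a a' : {y // y ∈ A} → V} (haa : ∀ x, x.1 ∈ C → a x = a' x) (b b' : {y // y ∉ A} → V) :
    let e := (Equiv.piEquivPiSubtypeProd (fun x => x ∈ A) (fun _ => V)).symm
    ∑ i, h i (e (a, b)) + ∑ i, h i (e (a', b')) =
      ∑ i, h i (e (a, b')) + ∑ i, h i (e (a', b)) := by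
  intro e
  rw [← Finset.sum_add_distrib, ← Finset.sum_add_distrib]
  refine Finset.sum_congr rfl fun i _ => ?_
  by_cases hi : ∃ y ∈ supp i, y ∉ A
  · have key : ∀ c, h i (e (a, c)) = h i (e (a', c)) := fun c => hdep i _ _ fun x hx => by
      by_cases hxA : x ∈ A
      · simp [e, Equiv.piEquivPiSubtypeProd, hxA, haa ⟨x, hxA⟩ (hC i x hx hxA hi)]
      · simp [e, Equiv.piEquivPiSubtypeProd, hxA]
    rw [key b, key b', add_comm]
  · push Not at hi
    have key : ∀ c, h i (e (c, b)) = h i (e (c, b')) := fun c => hdep i _ _ fun x hx => by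
      simp [e, Equiv.piEquivPiSubtypeProd, hi x hx]
    rw [key a, key a']

/-- Theorem 4 (classical temperature-independent area law): for the Gibbs distribution of a
classical local Hamiltonian, `D_α(P ‖ P_A ⊗ P_B) ≤ (|∂A| + |∂B|)·log d` for `α ∈ (0,1)∪(1,2]`. -/
theorem classical_renyi_mutual_information_area_law
    {Λ : Type*} [Fintype Λ] [DecidableEq Λ] {d : ℕ} (hd : 0 < d)
    {I : Type*} [Fintype I]
    (h : I → (Λ → Fin d) → ℝ) (supp : I → Finset Λ)
    (hdep : ∀ i, ∀ s t : Λ → Fin d, (∀ x ∈ supp i, s x = t x) → h i s = h i t)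
    (A B : Finset Λ) (hB : B = Aᶜ)
    (bA bB : Finset Λ)
    (hbA : bA = A.filter fun x => ∃ i, x ∈ supp i ∧ (supp i ∩ B).Nonempty)
    (hbB : bB = B.filter fun x => ∃ i, x ∈ supp i ∧ (supp i ∩ A).Nonempty)
    (H : (Λ → Fin d) → ℝ) (hH : ∀ s, H s = ∑ i, h i s)
    (β : ℝ) (hβ : 0 < β)
    (P : (Λ → Fin d) → ℝ)
    (hP : ∀ s, P s = Real.exp (-(β * H s)) / ∑ s', Real.exp (-(β * H s')))
    (PA : (({y : Λ // y ∈ A}) → Fin d) → ℝ)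
    (PB : (({y : Λ // y ∉ A}) → Fin d) → ℝ)
    (hPA : ∀ a, PA a = ∑ b, P ((Equiv.piEquivPiSubtypeProd
      (fun x => x ∈ A) (fun _ => Fin d)).symm (a, b)))
    (hPB : ∀ b, PB b = ∑ a, P ((Equiv.piEquivPiSubtypeProd
      (fun x => x ∈ A) (fun _ => Fin d)).symm (a, b)))
    (α : ℝ) (hα : α ∈ Set.Ioo (0:ℝ) 1 ∪ Set.Ioc 1 2) :
    renyiDiv α P (fun s => PA (fun x => s x.1) * PB (fun x => s x.1)) ≤
      (bA.card + bB.card) * Real.log d := by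
  have : Nonempty (Fin d) := ⟨⟨0, hd⟩⟩
  set e := (Equiv.piEquivPiSubtypeProd (fun x => x ∈ A) (fun _ => Fin d)).symm
  have hZ : 0 < ∑ s', Real.exp (-(β * H s')) :=
    Finset.sum_pos (fun s _ => Real.exp_pos _) Finset.univ_nonempty
  have hPpos : ∀ s, 0 < P s := fun s => by
    rw [hP]
    exact div_pos (Real.exp_pos _) hZ
  have hPsum : ∑ s, P s = 1 := by
    simp_rw [hP]
    rw [← Finset.sum_div, div_self hZ.ne']
  have hPApos : ∀ a, 0 < PA a := fun a => by
    rw [hPA]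
    exact Finset.sum_pos (fun b _ => hPpos _) Finset.univ_nonempty
  have hPBpos : ∀ b, 0 < PB b := fun b => by
    rw [hPB]
    exact Finset.sum_pos (fun a _ => hPpos _) Finset.univ_nonempty
  refine (renyiDiv_le_log_sum_sq_div hPpos
    (fun s => mul_pos (hPApos _) (hPBpos _)) hPsum hα).trans ?_
  have hcut : ∀ i, ∀ x ∈ supp i, x ∈ A → (∃ y ∈ supp i, y ∉ A) → x ∈ bA := by
    rintro i x hx hxA ⟨y, hy, hyA⟩
    rw [hbA, Finset.mem_filter]
    exact ⟨hxA, i, hx, y, by simp [hB, hy, hyA]⟩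
  have hsub : ∀ x : {y // y ∈ bA}, x.1 ∈ A := fun x =>
    Finset.filter_subset _ _ (hbA.subset x.2)
  let restrict : ({y // y ∈ A} → Fin d) → ({y // y ∈ bA} → Fin d) :=
    fun a x => a ⟨x.1, hsub x⟩
  let extend : ({y // y ∈ bA} → Fin d) → ({y // y ∈ A} → Fin d) :=
    fun c x => if hx : x.1 ∈ bA then c ⟨x.1, hx⟩ else ⟨0, hd⟩
  have hcross : ∀ a b b', P (e (a, b)) * P (e (extend (restrict a), b')) =
      P (e (a, b')) * P (e (extend (restrict a), b)) := by
    intro a b b'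
    have hE := energy_exchange hdep hcut (a := a) (a' := extend (restrict a))
      (fun x hx => by simp [extend, restrict, hx]) b b'
    simp only [← hH] at hE
    simp only [hP, div_mul_div_comm, ← Real.exp_add]
    congr 2
    have hE' := congrArg (fun t => -(β * t)) hE
    simp only [mul_add, neg_add] at hE'
    exact hE'
  have hbound := sum_sq_div_marginals_le_card (P := fun a b => P (e (a, b)))
    (fun a b => hPpos _) restrict extend hcross
  simp only [← hPA, ← hPB] at hbound
  have hsplit : ∑ s, P s ^ 2 / (PA (fun x => s x.1) * PB (fun x => s x.1)) =
      ∑ a, ∑ b, P (e (a, b)) ^ 2 / (PA a * PB b) := by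
    rw [← Fintype.sum_prod_type', ← Equiv.sum_comp e.symm]
    refine Finset.sum_congr rfl fun s _ => ?_
    rw [Prod.mk.eta, Equiv.apply_symm_apply]
    rfl
  have hpos : 0 < ∑ s, P s ^ 2 / (PA (fun x => s x.1) * PB (fun x => s x.1)) :=
    Finset.sum_pos (fun s _ => div_pos (pow_pos (hPpos s) 2) (mul_pos (hPApos _) (hPBpos _)))
      Finset.univ_nonempty
  have hcard : (Fintype.card ({y // y ∈ bA} → Fin d) : ℝ) = (d : ℝ) ^ bA.card := by
    simp
  have hd1 : 0 ≤ Real.log d := Real.log_natCast_nonneg d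
  calc Real.log (∑ s, P s ^ 2 / (PA (fun x => s x.1) * PB (fun x => s x.1)))
      ≤ Real.log ((d : ℝ) ^ bA.card) := by
        refine Real.log_le_log hpos ?_
        rw [hsplit, ← hcard]
        exact hbound
    _ = bA.card * Real.log d := Real.log_pow _ _
    _ ≤ (bA.card + bB.card) * Real.log d :=
        mul_le_mul_of_nonneg_right (by simp) hd1
end

section
/- Let A°, ∂A, ∂B, B° be finite sets and let P be a strictly positive probability distribution on A° × ∂A × ∂B × B°, writing X_{A°}, X_{∂A}, X_{∂B}, X_{B°} for the coordinate random variables, X_A = (X_{A°}, X_{∂A}) and X_B = (X_{∂B}, X_{B°}). Assume the Markov conditions: (i) X_A and X_{B°} are conditionally independent given X_{∂B}, and (ii) X_B and X_{A°} are conditionally independent given X_{∂A}. Then for every α > 0 with α ≠ 1, D_α(P_{AB} ‖ P_A ⊗ P_B) = D_α(P_{∂A ∂B} ‖ P_{∂A} ⊗ P_{∂B}), where P_{AB} = P, P_A, P_B, P_{∂A ∂B}, P_{∂A}, P_{∂B} are the indicated marginal distributions. -/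
/-- Rescaling both densities by a common factor `c > 0` rescales the Rényi integrand by `c`. -/
theorem mul_rpow_mul_mul_rpow_one_sub {c x y : ℝ} (hc : 0 < c) (hx : 0 ≤ x) (hy : 0 ≤ y) (α : ℝ) :
    (c * x) ^ α * (c * y) ^ (1 - α) = c * (x ^ α * y ^ (1 - α)) := by
  have hcc : c ^ α * c ^ (1 - α) = c := by
    rw [← Real.rpow_add hc, add_sub_cancel, Real.rpow_one]
  rw [Real.mul_rpow hc.le hx, Real.mul_rpow hc.le hy, mul_mul_mul_comm, hcc]

/-- Markov-chain reduction of the Rényi mutual information to the boundaries: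
if `X_A ⟂ X_{B°} | X_{∂B}` and `X_B ⟂ X_{A°} | X_{∂A}`, then
`D_α(P_{AB} ‖ P_A ⊗ P_B) = D_α(P_{∂A∂B} ‖ P_{∂A} ⊗ P_{∂B})`. -/
theorem renyi_mutual_information_eq_boundary
    {A0 DA DB B0 : Type*} [Fintype A0] [Fintype DA] [Fintype DB] [Fintype B0]
    (p : A0 × DA × DB × B0 → ℝ)
    (hpos : ∀ z, 0 < p z) (hsum : ∑ z, p z = 1)
    -- marginals
    (pA : A0 × DA → ℝ) (hpA : ∀ a1 a2, pA (a1, a2) = ∑ w, ∑ b2, p (a1, a2, w, b2))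
    (pB : DB × B0 → ℝ) (hpB : ∀ w b2, pB (w, b2) = ∑ a1, ∑ a2, p (a1, a2, w, b2))
    (pdA : DA → ℝ) (hpdA : ∀ a2, pdA a2 = ∑ a1, ∑ w, ∑ b2, p (a1, a2, w, b2))
    (pdB : DB → ℝ) (hpdB : ∀ w, pdB w = ∑ a1, ∑ a2, ∑ b2, p (a1, a2, w, b2))
    (pdAdB : DA × DB → ℝ)
    (hpdAdB : ∀ a2 w, pdAdB (a2, w) = ∑ a1, ∑ b2, p (a1, a2, w, b2))
    -- (i) X_A = (X_{A°}, X_{∂A}) and X_{B°} are conditionally independent given X_{∂B}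
    (hmarkov1 : ∀ a1 a2 w b2,
      p (a1, a2, w, b2) / pdB w =
        ((∑ b2', p (a1, a2, w, b2')) / pdB w) * ((∑ a1', ∑ a2', p (a1', a2', w, b2)) / pdB w))
    -- (ii) X_B = (X_{∂B}, X_{B°}) and X_{A°} are conditionally independent given X_{∂A}
    (hmarkov2 : ∀ a1 a2 w b2,
      p (a1, a2, w, b2) / pdA a2 =
        ((∑ w', ∑ b2', p (a1, a2, w', b2')) / pdA a2) *
          ((∑ a1', p (a1', a2, w, b2)) / pdA a2))
    (α : ℝ) (hα : 0 < α) (hα1 : α ≠ 1) :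
    renyiDiv α p (fun z => pA (z.1, z.2.1) * pB (z.2.2.1, z.2.2.2)) =
      renyiDiv α pdAdB (fun z => pdA z.1 * pdB z.2) := by
  have hne : Nonempty (A0 × DA × DB × B0) := by
    by_contra h
    rw [not_nonempty_iff] at h
    simp at hsum
  obtain ⟨⟨a₀, s₀, w₀, b₀⟩⟩ := hne
  have : Nonempty A0 := ⟨a₀⟩
  have : Nonempty DA := ⟨s₀⟩
  have : Nonempty DB := ⟨w₀⟩
  have : Nonempty B0 := ⟨b₀⟩
  have pA_pos : ∀ a s, 0 < pA (a, s) := fun a s => by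
    rw [hpA]
    exact Finset.sum_pos (fun _ _ => Finset.sum_pos (fun _ _ => hpos _) Finset.univ_nonempty)
      Finset.univ_nonempty
  have pB_pos : ∀ w b, 0 < pB (w, b) := fun w b => by
    rw [hpB]
    exact Finset.sum_pos (fun _ _ => Finset.sum_pos (fun _ _ => hpos _) Finset.univ_nonempty)
      Finset.univ_nonempty
  have pdAdB_pos : ∀ s w, 0 < pdAdB (s, w) := fun s w => by
    rw [hpdAdB]
    exact Finset.sum_pos (fun _ _ => Finset.sum_pos (fun _ _ => hpos _) Finset.univ_nonempty)
      Finset.univ_nonempty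
  have sum_pA : ∀ s, ∑ a, pA (a, s) = pdA s := fun s => by simp only [hpA, hpdA]
  have sum_pB : ∀ w, ∑ b, pB (w, b) = pdB w := fun w => by
    simp only [hpB, hpdB]
    rw [Finset.sum_comm]
    exact Finset.sum_congr rfl fun _ _ => Finset.sum_comm
  have pdA_pos : ∀ s, 0 < pdA s := fun s =>
    sum_pA s ▸ Finset.sum_pos (fun a _ => pA_pos a s) Finset.univ_nonempty
  have pdB_pos : ∀ w, 0 < pdB w := fun w =>
    sum_pB w ▸ Finset.sum_pos (fun b _ => pB_pos w b) Finset.univ_nonempty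
  have markov_B : ∀ a s w b, p (a, s, w, b) = (∑ b', p (a, s, w, b')) * (pB (w, b) / pdB w) :=
    fun a s w b => by
      have h := hmarkov1 a s w b
      have := (pdB_pos w).ne'
      rw [← hpB] at h
      field_simp at h ⊢
      linarith
  have sum_A0 : ∀ s w b, ∑ a, p (a, s, w, b) = pdAdB (s, w) * (pB (w, b) / pdB w) :=
    fun s w b => by
      rw [hpdAdB, Finset.sum_mul]
      exact Finset.sum_congr rfl fun a _ => markov_B a s w b
  have factor : ∀ a s w b,
      p (a, s, w, b) = pA (a, s) / pdA s * (pB (w, b) / pdB w) * pdAdB (s, w) :=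
    fun a s w b => by
      have h := hmarkov2 a s w b
      have := (pdA_pos s).ne'
      have := (pdB_pos w).ne'
      rw [← hpA, sum_A0] at h
      field_simp at h ⊢
      linarith
  have integrand : ∀ a s w b,
      p (a, s, w, b) ^ α * (pA (a, s) * pB (w, b)) ^ (1 - α) =
        pA (a, s) / pdA s * (pB (w, b) / pdB w) *
          (pdAdB (s, w) ^ α * (pdA s * pdB w) ^ (1 - α)) :=
    fun a s w b => by
      have hs := pdA_pos s
      have hw := pdB_pos w
      rw [← mul_rpow_mul_mul_rpow_one_sub
        (mul_pos (div_pos (pA_pos a s) hs) (div_pos (pB_pos w b) hw))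
        (pdAdB_pos s w).le (mul_pos hs hw).le, ← factor, div_mul_div_comm,
        div_mul_cancel₀ _ (mul_pos hs hw).ne']
  unfold renyiDiv
  congr 2
  simp only [Fintype.sum_prod_type, integrand]
  rw [Finset.sum_comm]
  refine Finset.sum_congr rfl fun s _ => ?_
  rw [Finset.sum_comm]
  refine Finset.sum_congr rfl fun w _ => ?_
  simp only [← Finset.sum_mul, ← Finset.mul_sum, ← Finset.sum_div, sum_pA, sum_pB,
    div_self (pdA_pos s).ne', div_self (pdB_pos w).ne', one_mul]
end

section
/- Let p be a probability distribution on a product of finite sets X × Y with marginals p_X and p_Y. Then for every α ∈ (0,1) ∪ (1,2], D_α(p ‖ p_X ⊗ p_Y) ≤ S_{2−α}(p) ≤ log(|X|·|Y|), where S_{2−α} is the Rényi entropy of order 2−α. -/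
/-- Rényi entropy of order `β ≠ 1`, `S_β(P) = (1−β)⁻¹ log ∑_x P(x)^β`, with the
convention `0^0 = 0` (so at `β = 0` the sum counts the support of `P`). -/
noncomputable def renyiEntropy {X : Type*} [Fintype X] (β : ℝ) (P : X → ℝ) : ℝ :=
  (1 - β)⁻¹ * Real.log (∑ x, if P x = 0 then 0 else P x ^ β)

/-- A probability vector has positive power sum over its support. -/
theorem sum_rpow_support_pos {ι : Type*} [Fintype ι] (β : ℝ) {P : ι → ℝ}
    (hP : ∀ i, 0 ≤ P i) (hsum : ∑ i, P i = 1) :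
    0 < ∑ i, if P i = 0 then 0 else P i ^ β := by
  obtain ⟨i, -, hi⟩ : ∃ i ∈ Finset.univ, P i ≠ 0 :=
    Finset.exists_ne_zero_of_sum_ne_zero (by rw [hsum]; exact one_ne_zero)
  refine Finset.sum_pos' (fun j _ => ?_) ⟨i, Finset.mem_univ i, ?_⟩
  · split_ifs
    exacts [le_rfl, Real.rpow_nonneg (hP j) β]
  · rw [if_neg hi]
    exact Real.rpow_pos_of_pos ((hP i).lt_of_ne' hi) β

theorem renyiEntropy_le_log_card {ι : Type*} [Fintype ι] {β : ℝ} (hβ0 : 0 ≤ β) (hβ1 : β ≠ 1)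
    {P : ι → ℝ} (hP : ∀ i, 0 ≤ P i) (hsum : ∑ i, P i = 1) :
    renyiEntropy β P ≤ Real.log (Fintype.card ι) := by
  have hne : Nonempty ι := by
    by_contra h
    rw [not_nonempty_iff] at h
    simp at hsum
  have hN : (0 : ℝ) < Fintype.card ι := by exact_mod_cast Fintype.card_pos
  have hpos := sum_rpow_support_pos β hP hsum
  set N : ℝ := (Fintype.card ι : ℝ) with hNdef
  have htangent : ∑ i, (1 + β * (N * P i - 1)) = N := by
    rw [Finset.sum_add_distrib, ← Finset.mul_sum, Finset.sum_sub_distrib, ← Finset.mul_sum, hsum]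
    simp [hNdef]
  have hscale : ∀ i, N ^ β * (if P i = 0 then 0 else P i ^ β) =
      if P i = 0 then 0 else (1 + (N * P i - 1)) ^ β := fun i => by
    split_ifs
    · simp
    · rw [add_sub_cancel, Real.mul_rpow hN.le (hP i)]
  have hge : ∀ i, -1 ≤ N * P i - 1 := fun i => by linarith [mul_nonneg hN.le (hP i)]
  have hlog : Real.log (N ^ β * ∑ i, if P i = 0 then 0 else P i ^ β) =
      β * Real.log N + Real.log (∑ i, if P i = 0 then 0 else P i ^ β) := by
    rw [Real.log_mul (Real.rpow_pos_of_pos hN β).ne' hpos.ne', Real.log_rpow hN]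
  unfold renyiEntropy
  rcases hβ1.lt_or_gt with h | h
  · have hle : N ^ β * ∑ i, (if P i = 0 then 0 else P i ^ β) ≤ N := by
      rw [Finset.mul_sum]
      refine (Finset.sum_le_sum fun i _ => ?_).trans_eq htangent
      rw [hscale]
      split_ifs with h0
      · rw [h0]; linarith
      · exact rpow_one_add_le_one_add_mul_self (hge i) hβ0 h.le
    have := Real.log_le_log (mul_pos (Real.rpow_pos_of_pos hN β) hpos) hle
    rw [inv_mul_le_iff₀ (by linarith)]
    linarith
  · have hle : N ≤ N ^ β * ∑ i, (if P i = 0 then 0 else P i ^ β) := by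
      rw [Finset.mul_sum]
      refine htangent.symm.trans_le (Finset.sum_le_sum fun i _ => ?_)
      rw [hscale]
      split_ifs with h0
      · rw [h0]; linarith
      · exact one_add_mul_self_le_rpow_one_add (hge i) h.le
    have := Real.log_le_log hN hle
    rw [← div_eq_inv_mul, div_le_iff_of_neg (by linarith)]
    linarith

theorem rpow_mul_sq_rpow {a : ℝ} (ha : 0 < a) (α : ℝ) :
    a ^ α * (a ^ 2) ^ (1 - α) = a ^ (2 - α) := by
  rw [← Real.rpow_natCast, ← Real.rpow_mul ha.le, ← Real.rpow_add ha]
  congr 1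
  push_cast
  ring

/-- If `P² ≤ Q` pointwise, the Rényi divergence is at most the Rényi entropy of dual order. -/
theorem renyiDiv_le_renyiEntropy {ι : Type*} [Fintype ι] {α : ℝ} (hα0 : 0 < α) (hα1 : α ≠ 1)
    {P Q : ι → ℝ} (hP : ∀ i, 0 ≤ P i) (hsum : ∑ i, P i = 1) (hPQ : ∀ i, P i ^ 2 ≤ Q i) :
    renyiDiv α P Q ≤ renyiEntropy (2 - α) P := by
  have hpos := sum_rpow_support_pos (2 - α) hP hsum
  unfold renyiDiv renyiEntropy
  rw [show 1 - (2 - α) = α - 1 by ring]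
  rcases hα1.lt_or_gt with h | h
  · refine mul_le_mul_of_nonpos_left (Real.log_le_log hpos (Finset.sum_le_sum fun i _ => ?_))
      (inv_nonpos.2 (by linarith))
    split_ifs with h0
    · simp [h0, hα0.ne']
    · rw [← rpow_mul_sq_rpow ((hP i).lt_of_ne' h0)]
      exact mul_le_mul_of_nonneg_left
        (Real.rpow_le_rpow (sq_nonneg _) (hPQ i) (by linarith)) (Real.rpow_nonneg (hP i) α)
  · refine mul_le_mul_of_nonneg_left (Real.log_le_log ?_ (Finset.sum_le_sum fun i _ => ?_))
      (inv_nonneg.2 (by linarith))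
    · have hQ : ∀ i, 0 ≤ Q i := fun i => (sq_nonneg _).trans (hPQ i)
      obtain ⟨i, -, hi⟩ : ∃ i ∈ Finset.univ, P i ≠ 0 :=
        Finset.exists_ne_zero_of_sum_ne_zero (by rw [hsum]; exact one_ne_zero)
      have hPi := (hP i).lt_of_ne' hi
      refine Finset.sum_pos' (fun j _ => mul_nonneg (Real.rpow_nonneg (hP j) _)
        (Real.rpow_nonneg (hQ j) _)) ⟨i, Finset.mem_univ i, ?_⟩
      exact mul_pos (Real.rpow_pos_of_pos hPi _)
        (Real.rpow_pos_of_pos ((pow_pos hPi 2).trans_le (hPQ i)) _)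
    · split_ifs with h0
      · simp [h0, hα0.ne']
      · have hPi := (hP i).lt_of_ne' h0
        rw [← rpow_mul_sq_rpow hPi]
        exact mul_le_mul_of_nonneg_left
          (Real.rpow_le_rpow_of_nonpos (pow_pos hPi 2) (hPQ i) (by linarith))
          (Real.rpow_nonneg (hP i) α)


/-- Dimension bound for the classical Rényi mutual information (Eq. (A21) of the paper):
`D_α(p ‖ p_X ⊗ p_Y) ≤ S_{2−α}(p) ≤ log(|X|·|Y|)` for `α ∈ (0,1)∪(1,2]`. -/
theorem classical_renyi_mutual_information_le_entropy_le_log_dim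
    {X Y : Type*} [Fintype X] [Fintype Y] [Nonempty X] [Nonempty Y]
    (p : X × Y → ℝ) (hp : ∀ z, 0 ≤ p z) (hsum : ∑ z, p z = 1)
    (pX : X → ℝ) (hpX : ∀ x, pX x = ∑ y, p (x, y))
    (pY : Y → ℝ) (hpY : ∀ y, pY y = ∑ x, p (x, y))
    (α : ℝ) (hα : α ∈ Set.Ioo (0:ℝ) 1 ∪ Set.Ioc 1 2) :
    renyiDiv α p (fun z => pX z.1 * pY z.2) ≤ renyiEntropy (2 - α) p ∧
      renyiEntropy (2 - α) p ≤ Real.log (Fintype.card X * Fintype.card Y) := by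
  have hα0 : 0 < α := by rcases hα with h | h <;> linarith [h.1]
  have hα1 : α ≠ 1 := by
    rcases hα with h | h
    exacts [h.2.ne, h.1.ne']
  have hα2 : α ≤ 2 := by rcases hα with h | h <;> linarith [h.2]
  refine ⟨renyiDiv_le_renyiEntropy hα0 hα1 hp hsum fun z => ?_, ?_⟩
  · have hX : p z ≤ pX z.1 := by
      rw [hpX]
      exact Finset.single_le_sum (f := fun y => p (z.1, y)) (fun y _ => hp _)
        (Finset.mem_univ z.2)
    have hY : p z ≤ pY z.2 := by
      rw [hpY]
      exact Finset.single_le_sum (f := fun x => p (x, z.2)) (fun x _ => hp _)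
        (Finset.mem_univ z.1)
    rw [sq]
    exact mul_le_mul hX hY (hp z) ((hp z).trans hX)
  · have := renyiEntropy_le_log_card (β := 2 - α) (by linarith)
      (fun h => hα1 (by linarith)) hp hsum
    rwa [Fintype.card_prod, Nat.cast_mul] at this
end

section
/- Fix α > 2. For every M ∈ ℝ there exists ε ∈ (0,1) such that the probability distribution p on {0,1}×{0,1} given by p(0,0) = ε, p(1,1) = 1−ε, p(0,1) = p(1,0) = 0 satisfies D_α(p ‖ p_X ⊗ p_Y) > M, where p_X, p_Y are the marginals of p. In particular, the classical Rényi mutual information D_α(p ‖ p_X ⊗ p_Y) of distributions on two bits is unbounded for α > 2. -/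
/-- A diagonal atom of mass `a` with both marginals equal to `a` contributes `a ^ (2 - α)`. -/
theorem rpow_mul_mul_self_rpow_one_sub {a : ℝ} (ha : 0 < a) (α : ℝ) :
    a ^ α * (a * a) ^ (1 - α) = a ^ (2 - α) := by
  rw [Real.mul_rpow ha.le ha.le, ← Real.rpow_add ha, ← Real.rpow_add ha]
  congr 1
  ring

/-- For `α > 2` the classical Rényi mutual information of two bits is unbounded:
for every `M` there is `ε ∈ (0,1)` such that the distribution
`p(0,0) = ε, p(1,1) = 1−ε, p(0,1) = p(1,0) = 0` has `D_α(p ‖ p_X ⊗ p_Y) > M`. -/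
theorem classical_renyi_mutual_information_unbounded_of_two_lt
    (α : ℝ) (hα : 2 < α) (M : ℝ) :
    ∃ ε : ℝ, 0 < ε ∧ ε < 1 ∧
      ∀ p : Fin 2 × Fin 2 → ℝ,
        (∀ z, p z = if z = (0, 0) then ε else if z = (1, 1) then 1 - ε else 0) →
        ∀ pX pY : Fin 2 → ℝ,
          (∀ x, pX x = ∑ y, p (x, y)) → (∀ y, pY y = ∑ x, p (x, y)) →
          M < renyiDiv α p (fun z => pX z.1 * pY z.2) := by
  have hα₁ : 0 < α - 1 := by linarith
  have hα₂ : 0 < α - 2 := by linarith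
  set t : ℝ := (|M| + 1) * (α - 1) / (α - 2) with ht
  have ht_pos : 0 < t := by positivity
  have hε : Real.exp (-t) < 1 := by simpa using ht_pos
  refine ⟨Real.exp (-t), Real.exp_pos _, hε, fun p hp pX pY hX hY => ?_⟩
  have hsum : ∑ z, p z ^ α * (pX z.1 * pY z.2) ^ (1 - α) =
      Real.exp (-t) ^ (2 - α) + (1 - Real.exp (-t)) ^ (2 - α) := by
    have hα₀ : α ≠ 0 := by linarith
    rw [← rpow_mul_mul_self_rpow_one_sub (Real.exp_pos (-t)) α,
      ← rpow_mul_mul_self_rpow_one_sub (sub_pos.2 hε) α]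
    simp [Fintype.sum_prod_type, Fin.sum_univ_two, hX, hY, hp, Real.zero_rpow hα₀]
  have hexp : Real.exp (-t) ^ (2 - α) = Real.exp ((|M| + 1) * (α - 1)) := by
    rw [← Real.exp_mul, ht]
    congr 1
    field_simp
    ring
  have hlog : (|M| + 1) * (α - 1) ≤
      Real.log (Real.exp (-t) ^ (2 - α) + (1 - Real.exp (-t)) ^ (2 - α)) := by
    rw [hexp, Real.le_log_iff_exp_le (by have := sub_pos.2 hε; positivity)]
    exact le_add_of_nonneg_right (Real.rpow_nonneg (sub_pos.2 hε).le _)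
  unfold renyiDiv
  rw [hsum, inv_mul_eq_div, lt_div_iff₀ hα₁]
  refine lt_of_lt_of_le ?_ hlog
  have := le_abs_self M
  gcongr
  linarith
end

section
/- Let ψ be a unit vector in ℂ^{d_A} ⊗ ℂ^{d_B}, let ρ_{AB} = |ψ⟩⟨ψ|, and let ρ_A = Tr_B ρ_{AB}, ρ_B = Tr_A ρ_{AB} be its marginals. Then for every α ∈ (0,1) ∪ (1,2), the sandwiched Rényi divergence satisfies D̃_α(ρ_{AB} ‖ ρ_A ⊗ ρ_B) = 2·S_{2/α − 1}(ρ_A). -/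
open scoped Kronecker
open Matrix

/-- Partial trace over the second (B) system. -/
noncomputable def ptraceB {A B : Type*} [Fintype B]
    (ρ : Matrix (A × B) (A × B) ℂ) : Matrix A A ℂ :=
  Matrix.of fun a a' => ∑ b, ρ (a, b) (a', b)

/-- Partial trace over the first (A) system. -/
noncomputable def ptraceA {A B : Type*} [Fintype A]
    (ρ : Matrix (A × B) (A × B) ℂ) : Matrix B B ℂ :=
  Matrix.of fun b b' => ∑ a, ρ (a, b) (a, b')

/-- Real power of a Hermitian matrix via spectral decomposition, convention `0^r = 0`
on the kernel; junk value `0` for non-Hermitian matrices. -/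
noncomputable def mPow {n : Type*} [Fintype n] [DecidableEq n]
    (M : Matrix n n ℂ) (r : ℝ) : Matrix n n ℂ :=
  if h : M.IsHermitian then
    (h.eigenvectorUnitary : Matrix n n ℂ) *
      Matrix.diagonal
        (fun i => ((if h.eigenvalues i = 0 then (0 : ℝ) else h.eigenvalues i ^ r : ℝ) : ℂ)) *
      star (h.eigenvectorUnitary : Matrix n n ℂ)
  else 0

/-- Sandwiched Rényi divergence
`D̃_α(ρ‖σ) = (α−1)⁻¹ log Tr[(σ^{(1−α)/(2α)} ρ σ^{(1−α)/(2α)})^α]`. -/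
noncomputable def sandwichedRenyiDiv {n : Type*} [Fintype n] [DecidableEq n]
    (α : ℝ) (ρ σ : Matrix n n ℂ) : ℝ :=
  (α - 1)⁻¹ *
    Real.log (Matrix.trace
      (mPow (mPow σ ((1 - α) / (2 * α)) * ρ * mPow σ ((1 - α) / (2 * α))) α)).re

/-- Rényi entropy of order `β`, `S_β(ρ) = (1−β)⁻¹ log Tr[ρ^β]`. -/
noncomputable def matrixRenyiEntropy {n : Type*} [Fintype n] [DecidableEq n]
    (β : ℝ) (ρ : Matrix n n ℂ) : ℝ :=
  (1 - β)⁻¹ * Real.log (Matrix.trace (mPow ρ β)).re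

/-- The scalar power function underlying `mPow`. -/
noncomputable def suppPow (r x : ℝ) : ℝ := if x = 0 then 0 else x ^ r

lemma suppPow_mul_suppPow {x : ℝ} (hx : 0 ≤ x) (r s : ℝ) :
    suppPow r x * suppPow s x = suppPow (r + s) x := by
  unfold suppPow
  split_ifs with h
  · simp
  · exact (Real.rpow_add (lt_of_le_of_ne hx (Ne.symm h)) r s).symm

lemma suppPow_mul {x y : ℝ} (hx : 0 ≤ x) (hy : 0 ≤ y) (r : ℝ) :
    suppPow r (x * y) = suppPow r x * suppPow r y := by
  unfold suppPow
  by_cases h : x = 0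
  · simp [h]
  by_cases h' : y = 0
  · simp [h']
  simp [h, h', Real.mul_rpow hx hy]

lemma exists_polynomial_eval_eq (f : ℝ → ℝ) (S : Finset ℝ) :
    ∃ p : Polynomial ℝ, ∀ x ∈ S, p.eval x = f x :=
  ⟨Lagrange.interpolate S id f, fun _ hx =>
    Lagrange.eval_interpolate_at_node f (Set.injOn_id _) hx⟩

section Matrix

open scoped ComplexOrder

variable {n : Type*} [Fintype n] [DecidableEq n]

lemma aeval_conj_diagonal {U : Matrix n n ℂ} (hU : star U * U = 1) (hU' : U * star U = 1)
    (d : n → ℝ) (p : Polynomial ℝ) :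
    Polynomial.aeval (U * diagonal (fun i => (d i : ℂ)) * star U) p =
      U * diagonal (fun i => ((p.eval (d i) : ℝ) : ℂ)) * star U := by
  have hpow (k : ℕ) : (U * diagonal (fun i => (d i : ℂ)) * star U) ^ k =
      U * diagonal (fun i => ((d i ^ k : ℝ) : ℂ)) * star U := by
    induction k with
    | zero => simp [hU']
    | succ k ih =>
      rw [pow_succ, ih]
      calc _ = U * diagonal (fun i => ((d i ^ k : ℝ) : ℂ)) * (star U * U) *
              diagonal (fun i => (d i : ℂ)) * star U := by simp only [mul_assoc]
        _ = _ := by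
          rw [hU, mul_one, mul_assoc U, diagonal_mul_diagonal]
          simp [pow_succ]
  induction p using Polynomial.induction_on' with
  | add p q hp hq =>
    simp only [map_add, hp, hq, Polynomial.eval_add, Complex.ofReal_add]
    rw [← diagonal_add, mul_add, add_mul]
  | monomial k a =>
    rw [Polynomial.aeval_monomial, hpow, ← Algebra.smul_def, ← smul_mul_assoc, ← mul_smul_comm]
    congr 2
    ext i j
    by_cases h : i = j <;> simp [h, diagonal]

lemma Matrix.IsHermitian.eq_conj_diagonal {M : Matrix n n ℂ} (h : M.IsHermitian) :
    M = (h.eigenvectorUnitary : Matrix n n ℂ) * diagonal (fun i => (h.eigenvalues i : ℂ)) *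
      star (h.eigenvectorUnitary : Matrix n n ℂ) := by
  conv_lhs => rw [h.spectral_theorem]
  rfl

lemma mPow_eq_conj_diagonal {M : Matrix n n ℂ} (h : M.IsHermitian) (r : ℝ) :
    mPow M r = (h.eigenvectorUnitary : Matrix n n ℂ) *
      diagonal (fun i => ((suppPow r (h.eigenvalues i) : ℝ) : ℂ)) *
      star (h.eigenvectorUnitary : Matrix n n ℂ) := by
  rw [mPow, dif_pos h]
  rfl

lemma mPow_eq_aeval {M : Matrix n n ℂ} (h : M.IsHermitian) {r : ℝ} {p : Polynomial ℝ}
    (hp : ∀ i, p.eval (h.eigenvalues i) = suppPow r (h.eigenvalues i)) :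
    mPow M r = Polynomial.aeval M p := by
  conv_rhs => rw [h.eq_conj_diagonal]
  rw [aeval_conj_diagonal (Unitary.coe_star_mul_self _) (Unitary.coe_mul_star_self _),
    mPow_eq_conj_diagonal h]
  simp only [hp]

lemma isHermitian_conj_diagonal (U : Matrix n n ℂ) (d : n → ℝ) :
    (U * diagonal (fun i => (d i : ℂ)) * star U).IsHermitian :=
  isHermitian_mul_mul_conjTranspose U (isHermitian_diagonal_of_self_adjoint _ (by
    ext i; simp))

lemma mPow_isHermitian {M : Matrix n n ℂ} (h : M.IsHermitian) (r : ℝ) :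
    (mPow M r).IsHermitian := by
  rw [mPow_eq_conj_diagonal h]
  exact isHermitian_conj_diagonal _ _

lemma mPow_conj_diagonal {U : Matrix n n ℂ} (hU : star U * U = 1) (hU' : U * star U = 1)
    (d : n → ℝ) (r : ℝ) :
    mPow (U * diagonal (fun i => (d i : ℂ)) * star U) r =
      U * diagonal (fun i => ((suppPow r (d i) : ℝ) : ℂ)) * star U := by
  have h := isHermitian_conj_diagonal U d
  obtain ⟨p, hp⟩ := exists_polynomial_eval_eq (suppPow r)
    (Finset.univ.image h.eigenvalues ∪ Finset.univ.image d)
  rw [mPow_eq_aeval h (p := p) fun i => hp _ (by simp), aeval_conj_diagonal hU hU']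
  simp only [hp _ (Finset.mem_union_right _ (Finset.mem_image_of_mem d (Finset.mem_univ _)))]

lemma mPow_mul_mPow {M : Matrix n n ℂ} (h : M.PosSemidef) (r s : ℝ) :
    mPow M r * mPow M s = mPow M (r + s) := by
  simp only [mPow_eq_conj_diagonal h.isHermitian]
  set U := (h.isHermitian.eigenvectorUnitary : Matrix n n ℂ)
  have hU : star U * U = 1 := Unitary.coe_star_mul_self _
  calc _ = U * diagonal (fun i => ((suppPow r (h.isHermitian.eigenvalues i) : ℝ) : ℂ)) *
        (star U * U) * diagonal (fun i => ((suppPow s (h.isHermitian.eigenvalues i) : ℝ) : ℂ)) *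
        star U := by simp only [mul_assoc]
    _ = _ := by
      rw [hU, mul_one, mul_assoc U, diagonal_mul_diagonal]
      simp only [← Complex.ofReal_mul, suppPow_mul_suppPow (h.eigenvalues_nonneg _)]

lemma mPow_one {M : Matrix n n ℂ} (h : M.IsHermitian) : mPow M 1 = M := by
  rw [mPow_eq_aeval h (p := Polynomial.X), Polynomial.aeval_X]
  intro i
  simp +contextual [suppPow]

lemma mPow_kronecker {m : Type*} [Fintype m] [DecidableEq m] {M : Matrix m m ℂ}
    {N : Matrix n n ℂ} (hM : M.PosSemidef) (hN : N.PosSemidef) (r : ℝ) :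
    mPow (M ⊗ₖ N) r = mPow M r ⊗ₖ mPow N r := by
  have hfac (V : Matrix m m ℂ) (W : Matrix n n ℂ) (f : m → ℝ) (g : n → ℝ) :
      (V * diagonal (fun i => (f i : ℂ)) * star V) ⊗ₖ
        (W * diagonal (fun i => (g i : ℂ)) * star W) =
      (V ⊗ₖ W) * diagonal (fun i => ((f i.1 * g i.2 : ℝ) : ℂ)) * star (V ⊗ₖ W) := by
    simp only [star_eq_conjTranspose, conjTranspose_kronecker, mul_kronecker_mul,
      diagonal_kronecker_diagonal, Complex.ofReal_mul]
  rw [mPow_eq_conj_diagonal hM.isHermitian, mPow_eq_conj_diagonal hN.isHermitian, hfac]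
  conv_lhs => rw [hM.isHermitian.eq_conj_diagonal, hN.isHermitian.eq_conj_diagonal, hfac]
  set V := (hM.isHermitian.eigenvectorUnitary : Matrix m m ℂ)
  set W := (hN.isHermitian.eigenvectorUnitary : Matrix n n ℂ)
  have hV : star V * V = 1 := Unitary.coe_star_mul_self _
  have hV' : V * star V = 1 := Unitary.coe_mul_star_self _
  have hW : star W * W = 1 := Unitary.coe_star_mul_self _
  have hW' : W * star W = 1 := Unitary.coe_mul_star_self _
  rw [star_eq_conjTranspose] at hV hV' hW hW'
  rw [mPow_conj_diagonal]
  · simp only [suppPow_mul (hM.eigenvalues_nonneg _) (hN.eigenvalues_nonneg _)]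
  · rw [star_eq_conjTranspose, conjTranspose_kronecker, ← mul_kronecker_mul, hV, hW,
      one_kronecker_one]
  · rw [star_eq_conjTranspose, conjTranspose_kronecker, ← mul_kronecker_mul, hV', hW',
      one_kronecker_one]

lemma aeval_mul_comm_intertwine {m : Type*} [Fintype m] [DecidableEq m] (M : Matrix m n ℂ)
    (N : Matrix n m ℂ) (p : Polynomial ℝ) :
    M * Polynomial.aeval (N * M) p = Polynomial.aeval (M * N) p * M := by
  have hpow (k : ℕ) : M * (N * M) ^ k = (M * N) ^ k * M := by
    induction k with
    | zero => simp
    | succ k ih =>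
      rw [pow_succ, ← Matrix.mul_assoc, ih, pow_succ]
      simp only [Matrix.mul_assoc]
  induction p using Polynomial.induction_on' with
  | add p q hp hq => simp only [map_add, Matrix.mul_add, Matrix.add_mul, hp, hq]
  | monomial k a =>
    simp only [Polynomial.aeval_monomial, ← Algebra.smul_def]
    rw [Matrix.mul_smul, hpow, Matrix.smul_mul]

lemma transpose_aeval (M : Matrix n n ℂ) (p : Polynomial ℝ) :
    (Polynomial.aeval M p)ᵀ = Polynomial.aeval Mᵀ p := by
  induction p using Polynomial.induction_on' with
  | add p q hp hq => simp only [map_add, transpose_add, hp, hq]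
  | monomial k a =>
    simp only [Polynomial.aeval_monomial, ← Algebra.smul_def, transpose_smul, transpose_pow]

/-- Powers of `M * Mᴴ` and `(Mᴴ * M)ᵀ` are intertwined by `M`. -/
lemma mul_transpose_mPow {m : Type*} [Fintype m] [DecidableEq m] (M : Matrix m n ℂ) (r : ℝ) :
    M * (mPow (Mᴴ * M)ᵀ r)ᵀ = mPow (M * Mᴴ) r * M := by
  have h₁ : (Mᴴ * M)ᵀ.IsHermitian := (isHermitian_conjTranspose_mul_self M).transpose
  have h₂ : (M * Mᴴ).IsHermitian := isHermitian_mul_conjTranspose_self M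
  obtain ⟨p, hp⟩ := exists_polynomial_eval_eq (suppPow r)
    (Finset.univ.image h₁.eigenvalues ∪ Finset.univ.image h₂.eigenvalues)
  rw [mPow_eq_aeval h₁ (p := p) fun i => hp _ (by simp),
    mPow_eq_aeval h₂ (p := p) fun i => hp _ (by simp), transpose_aeval, transpose_transpose,
    aeval_mul_comm_intertwine]

lemma eigenvalues_vecMulVec_star {v : n → ℂ} {c : ℝ} (hc : star v ⬝ᵥ v = c)
    (h : (vecMulVec v (star v)).IsHermitian) (i : n) :
    h.eigenvalues i = 0 ∨ h.eigenvalues i = c := by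
  have hsq : vecMulVec v (star v) * vecMulVec v (star v) = (c : ℂ) • vecMulVec v (star v) := by
    rw [vecMulVec_mul_vecMulVec, hc, vecMulVec_smul]
  set w := (h.eigenvectorBasis i).ofLp with hw
  have he : vecMulVec v (star v) *ᵥ w = h.eigenvalues i • w := h.mulVec_eigenvectorBasis i
  have hw0 : w ≠ 0 := by
    intro h0
    exact h.eigenvectorBasis.orthonormal.ne_zero i (by ext j; exact congrFun h0 j)
  have h2 := congrArg (· *ᵥ w) hsq
  simp only [← mulVec_mulVec, smul_mulVec, he, mulVec_smul] at h2
  obtain ⟨j, hj⟩ := Function.ne_iff.mp hw0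
  have h3 := congrFun h2 j
  simp only [Pi.smul_apply, Complex.real_smul, smul_eq_mul, ← mul_assoc] at h3
  have h4 := mul_right_cancel₀ hj h3
  norm_cast at h4
  rcases eq_or_ne (h.eigenvalues i) 0 with h0 | h0
  · exact Or.inl h0
  · exact Or.inr (mul_right_cancel₀ h0 h4)

lemma trace_mPow_vecMulVec_star {v : n → ℂ} {c : ℝ} (hc : star v ⬝ᵥ v = c) (hc0 : 0 ≤ c)
    {r : ℝ} (hr : r ≠ 0) : (mPow (vecMulVec v (star v)) r).trace = ((c ^ r : ℝ) : ℂ) := by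
  have h : (vecMulVec v (star v)).IsHermitian := (posSemidef_vecMulVec_self_star v).isHermitian
  have hscalar (x : ℝ) (hx : x = 0 ∨ x = c) : c ^ (r - 1) * x = suppPow r x := by
    rcases eq_or_ne x 0 with rfl | h0
    · simp [suppPow]
    · obtain rfl : x = c := hx.resolve_left h0
      rw [suppPow, if_neg h0, Real.rpow_sub_one h0, div_mul_cancel₀ _ h0]
  rw [mPow_eq_aeval h (p := Polynomial.C (c ^ (r - 1)) * Polynomial.X) fun i => by
    simpa using hscalar _ (eigenvalues_vecMulVec_star hc h i)]
  rw [map_mul, Polynomial.aeval_C, Polynomial.aeval_X, ← Algebra.smul_def, trace_smul,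
    trace_vecMulVec, dotProduct_comm, hc, Complex.real_smul, ← Complex.ofReal_mul]
  rcases eq_or_ne c 0 with rfl | h0
  · simp [Real.zero_rpow hr]
  · rw [Real.rpow_sub_one h0, div_mul_cancel₀ _ h0]

end Matrix

/-- Eq. (A23) of the paper: for a pure state `ρ_{AB} = |ψ⟩⟨ψ|` and `α ∈ (0,1)∪(1,2)`,
`D̃_α(ρ_{AB} ‖ ρ_A ⊗ ρ_B) = 2·S_{2/α−1}(ρ_A)`. -/
theorem sandwiched_renyi_mutual_information_pure_state
    {dA dB : ℕ} (hdA : 0 < dA) (hdB : 0 < dB)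
    (ψ : Fin dA × Fin dB → ℂ) (hψ : ∑ z, ‖ψ z‖ ^ 2 = 1)
    (ρAB : Matrix (Fin dA × Fin dB) (Fin dA × Fin dB) ℂ)
    (hρAB : ρAB = Matrix.vecMulVec ψ (star ψ))
    (α : ℝ) (hα : α ∈ Set.Ioo (0:ℝ) 1 ∪ Set.Ioo 1 2) :
    sandwichedRenyiDiv α ρAB (ptraceB ρAB ⊗ₖ ptraceA ρAB) =
      2 * matrixRenyiEntropy (2 / α - 1) (ptraceB ρAB) := by
  have hα0 : α ≠ 0 := by rcases hα with h | h <;> linarith [h.1, h.2]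
  have hα1 : α - 1 ≠ 0 := by rcases hα with h | h <;> linarith [h.1, h.2]
  subst hρAB
  set M : Matrix (Fin dA) (Fin dB) ℂ := Matrix.of fun a b => ψ (a, b) with hM
  have hA : ptraceB (vecMulVec ψ (star ψ)) = M * Mᴴ := by
    ext a a'
    simp [ptraceB, hM, mul_apply, vecMulVec_apply]
  have hB : ptraceA (vecMulVec ψ (star ψ)) = (Mᴴ * M)ᵀ := by
    ext b b'
    simp [ptraceA, hM, mul_apply, vecMulVec_apply, mul_comm]
  open scoped ComplexOrder in
  have hApos : (M * Mᴴ).PosSemidef := posSemidef_self_mul_conjTranspose M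
  open scoped ComplexOrder in
  have hBpos : (Mᴴ * M)ᵀ.PosSemidef := (posSemidef_conjTranspose_mul_self M).transpose
  rw [hA, hB, sandwichedRenyiDiv, matrixRenyiEntropy]
  set s := (1 - α) / (2 * α) with hs
  set A := M * Mᴴ
  set σs := mPow (A ⊗ₖ (Mᴴ * M)ᵀ) s
  set K := mPow A (2 * s) * M with hK
  set v : Fin dA × Fin dB → ℂ := σs *ᵥ ψ with hv
  have hσ : σsᴴ = σs := mPow_isHermitian (hApos.kronecker hBpos).isHermitian s
  have hρ : σs * vecMulVec ψ (star ψ) * σs = vecMulVec v (star v) := by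
    rw [mul_vecMulVec, vecMulVec_mul, hv, star_mulVec, hσ]
  have hvK (z : Fin dA × Fin dB) : v z = K z.1 z.2 := by
    have h : K = mPow A s * M * (mPow (Mᴴ * M)ᵀ s)ᵀ := by
      rw [Matrix.mul_assoc, mul_transpose_mPow, ← Matrix.mul_assoc, mPow_mul_mPow hApos,
        ← two_mul]
    have hMψ (a : Fin dA) (b : Fin dB) : M a b = ψ (a, b) := rfl
    rw [h, hv]
    simp only [σs, mPow_kronecker hApos hBpos, mulVec, dotProduct, Fintype.sum_prod_type,
      kroneckerMap_apply, mul_apply, transpose_apply (mPow _ _), hMψ, Finset.sum_mul]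
    rw [Finset.sum_comm]
    refine Finset.sum_congr rfl fun _ _ => Finset.sum_congr rfl fun _ _ => by ring
  have htr : star v ⬝ᵥ v = (mPow A (2 / α - 1)).trace := by
    have h1 : star v ⬝ᵥ v = (K * Kᴴ).trace := by
      simp [dotProduct, Fintype.sum_prod_type, trace, mul_apply, hvK, mul_comm]
    have h2 : K * Kᴴ = mPow A (2 * s) * mPow A 1 * mPow A (2 * s) := by
      rw [hK, conjTranspose_mul, mPow_isHermitian hApos.isHermitian, mPow_one hApos.isHermitian]
      simp only [A, Matrix.mul_assoc]
    rw [h1, h2, mPow_mul_mPow hApos, mPow_mul_mPow hApos]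
    congr 2
    rw [hs]
    field_simp
    ring
  set c : ℝ := ∑ z, ‖v z‖ ^ 2
  have hc : star v ⬝ᵥ v = (c : ℂ) := by
    simp [c, dotProduct, Complex.conj_mul']
  have hc0 : 0 ≤ c := Finset.sum_nonneg fun _ _ => by positivity
  rw [hρ, trace_mPow_vecMulVec_star hc hc0 hα0, ← htr, hc, Complex.ofReal_re, Complex.ofReal_re]
  have hlog : Real.log (c ^ α) = α * Real.log c := by
    rcases hc0.eq_or_lt with h | h
    · simp [← h, Real.zero_rpow hα0]
    · exact Real.log_rpow h α
  have hβ : 1 - (2 / α - 1) = 2 * (α - 1) / α := by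
    field_simp
    ring
  rw [hlog, hβ]
  field_simp
end

section
/- Let ρ and σ be density matrices of the same finite dimension and let α ∈ (0,1) ∪ (1,∞). Then there exists an orthogonal projection P such that, setting p = (Tr[ρP], 1 − Tr[ρP]) and q = (Tr[σP], 1 − Tr[σP]) as probability distributions on two outcomes, one has D_α(p ‖ q) ≥ min{1, α} · ‖ρ − σ‖₁² / 2. -/
open Matrix Classical
open scoped ComplexOrder

/-- Trace norm (sum of singular values): `‖M‖₁ = Tr[(MᴴM)^{1/2}]`. -/
noncomputable def traceNorm {n : Type*} [Fintype n] [DecidableEq n]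
    (M : Matrix n n ℂ) : ℝ :=
  (Matrix.trace (mPow (Mᴴ * M) (1 / 2))).re

/-- Classical Rényi divergence, extended-real valued: `+∞` when `α > 1` and the support of
`P` is not contained in that of `Q`; otherwise `(α−1)⁻¹ log ∑_x P(x)^α Q(x)^{1−α}` with the
convention `0^t = 0` for `t ≠ 0`. -/
noncomputable def renyiDivE {X : Type*} [Fintype X] (α : ℝ) (P Q : X → ℝ) : EReal :=
  if 1 < α ∧ ∃ x, 0 < P x ∧ Q x = 0 then ⊤
  else (((α - 1)⁻¹ * Real.log (∑ x, P x ^ α * Q x ^ (1 - α)) : ℝ) : EReal)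

/-- Pinsker's inequality for two-point distributions with full support. -/
theorem binary_pinsker {r p : ℝ} (hr : r ∈ Set.Ioo (0 : ℝ) 1) (hp : p ∈ Set.Ioo (0 : ℝ) 1) :
    2 * (r - p) ^ 2 ≤
      r * (Real.log r - Real.log p) + (1 - r) * (Real.log (1 - r) - Real.log (1 - p)) := by
  obtain ⟨hr0, hr1⟩ := hr
  let g : ℝ → ℝ := fun x ↦
    r * (Real.log r - Real.log x) + (1 - r) * (Real.log (1 - r) - Real.log (1 - x)) -
      2 * (r - x) ^ 2
  have hderiv : ∀ x ∈ Set.Ioo (0 : ℝ) 1,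
      HasDerivAt g ((x - r) * ((1 - 2 * x) ^ 2 / (x * (1 - x)))) x := by
    rintro x ⟨hx0, hx1⟩
    have hx1' : 1 - x ≠ 0 := by linarith
    have h1 := (((Real.hasDerivAt_log hx0.ne').const_sub (Real.log r)).const_mul r)
    have h2 := ((((hasDerivAt_id x).const_sub 1).log hx1').const_sub
      (Real.log (1 - r))).const_mul (1 - r)
    have h3 := (((hasDerivAt_id x).const_sub r).pow 2).const_mul 2
    refine ((h1.add h2).sub h3).congr_deriv ?_
    simp only [id]
    field_simp
    ring
  have hsign : ∀ x ∈ Set.Ioo (0 : ℝ) 1, 0 ≤ (1 - 2 * x) ^ 2 / (x * (1 - x)) := by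
    rintro x ⟨hx0, hx1⟩
    have : 0 < 1 - x := by linarith
    positivity
  have hgr : g r = 0 := by simp [g]
  suffices h : g r ≤ g p by
    rw [hgr] at h
    simp only [g] at h
    linarith
  rcases le_total p r with hpr | hrp
  · have hsub : Set.Icc p r ⊆ Set.Ioo 0 1 := fun x hx ↦
      ⟨hp.1.trans_le hx.1, hx.2.trans_lt hr1⟩
    refine antitoneOn_of_deriv_nonpos (convex_Icc p r)
      (fun x hx ↦ (hderiv x (hsub hx)).continuousAt.continuousWithinAt)
      (fun x hx ↦ (hderiv x (hsub (interior_subset hx))).differentiableAt.differentiableWithinAt)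
      (fun x hx ↦ ?_) (Set.left_mem_Icc.2 hpr) (Set.right_mem_Icc.2 hpr) hpr
    have hx' := interior_subset hx
    rw [(hderiv x (hsub hx')).deriv]
    exact mul_nonpos_of_nonpos_of_nonneg (by linarith [hx'.2]) (hsign x (hsub hx'))
  · have hsub : Set.Icc r p ⊆ Set.Ioo 0 1 := fun x hx ↦
      ⟨hr0.trans_le hx.1, hx.2.trans_lt hp.2⟩
    refine monotoneOn_of_deriv_nonneg (convex_Icc r p)
      (fun x hx ↦ (hderiv x (hsub hx)).continuousAt.continuousWithinAt)
      (fun x hx ↦ (hderiv x (hsub (interior_subset hx))).differentiableAt.differentiableWithinAt)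
      (fun x hx ↦ ?_) (Set.left_mem_Icc.2 hrp) (Set.right_mem_Icc.2 hrp) hrp
    have hx' := interior_subset hx
    rw [(hderiv x (hsub hx')).deriv]
    exact mul_nonneg (by linarith [hx'.1]) (hsign x (hsub hx'))

/-- The sum `∑ₓ P(x)^α Q(x)^{1-α}` for the two-point distributions `(p, 1 - p)`, `(q, 1 - q)`. -/
noncomputable def binaryRenyiSum (α p q : ℝ) : ℝ :=
  p ^ α * q ^ (1 - α) + (1 - p) ^ α * (1 - q) ^ (1 - α)

theorem log_rpow_mul_rpow {p q : ℝ} (hp : 0 < p) (hq : 0 < q) (a b : ℝ) :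
    Real.log (p ^ a * q ^ b) = a * Real.log p + b * Real.log q := by
  rw [Real.log_mul (Real.rpow_pos_of_pos hp a).ne' (Real.rpow_pos_of_pos hq b).ne',
    Real.log_rpow hp, Real.log_rpow hq]

/-- Normalizing the two terms of `binaryRenyiSum α p q` gives a two-point distribution
`(r, 1 - r)` with full support. -/
theorem exists_tilted_weight (α : ℝ) {p q : ℝ} (hp : p ∈ Set.Ioo (0 : ℝ) 1)
    (hq : q ∈ Set.Ioo (0 : ℝ) 1) :
    0 < binaryRenyiSum α p q ∧ ∃ r ∈ Set.Ioo (0 : ℝ) 1,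
      Real.log r = α * Real.log p + (1 - α) * Real.log q - Real.log (binaryRenyiSum α p q) ∧
      Real.log (1 - r) = α * Real.log (1 - p) + (1 - α) * Real.log (1 - q) -
        Real.log (binaryRenyiSum α p q) := by
  obtain ⟨hp0, hp1⟩ := hp
  obtain ⟨hq0, hq1⟩ := hq
  have hp1' : 0 < 1 - p := by linarith
  have hq1' : 0 < 1 - q := by linarith
  have ha := log_rpow_mul_rpow hp0 hq0 α (1 - α)
  have hb := log_rpow_mul_rpow hp1' hq1' α (1 - α)
  have ha0 : 0 < p ^ α * q ^ (1 - α) := by positivity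
  have hb0 : 0 < (1 - p) ^ α * (1 - q) ^ (1 - α) := by positivity
  unfold binaryRenyiSum
  set a := p ^ α * q ^ (1 - α)
  set b := (1 - p) ^ α * (1 - q) ^ (1 - α)
  have hS : 0 < a + b := by positivity
  have hr : 1 - a / (a + b) = b / (a + b) := by field_simp; ring
  have hb' : 0 < b / (a + b) := by positivity
  refine ⟨hS, a / (a + b), ⟨by positivity, by linarith⟩, ?_, ?_⟩
  · rw [Real.log_div ha0.ne' hS.ne', ha]
  · rw [hr, Real.log_div hb0.ne' hS.ne', hb]

theorem continuous_binaryRenyiSum {α : ℝ} (hα : 0 < α) (hα1 : α < 1) :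
    Continuous fun x : ℝ × ℝ ↦ binaryRenyiSum α x.1 x.2 := by
  have h1 : 0 ≤ α := hα.le
  have h2 : 0 ≤ 1 - α := by linarith
  unfold binaryRenyiSum
  fun_prop (disch := assumption)

theorem binaryRenyiSum_le_exp {α p q : ℝ} (hα : 0 < α) (hα1 : α < 1)
    (hp : p ∈ Set.Icc (0 : ℝ) 1) (hq : q ∈ Set.Icc (0 : ℝ) 1) :
    binaryRenyiSum α p q ≤ Real.exp (-(2 * α * (1 - α) * (p - q) ^ 2)) := by
  have hclosed : IsClosed {x : ℝ × ℝ | binaryRenyiSum α x.1 x.2 ≤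
      Real.exp (-(2 * α * (1 - α) * (x.1 - x.2) ^ 2))} :=
    isClosed_le (continuous_binaryRenyiSum hα hα1) (by fun_prop)
  have hmem : (p, q) ∈ closure (Set.Ioo (0 : ℝ) 1 ×ˢ Set.Ioo (0 : ℝ) 1) := by
    rw [closure_prod_eq, closure_Ioo zero_ne_one]
    exact ⟨hp, hq⟩
  refine closure_minimal ?_ hclosed hmem
  rintro ⟨p, q⟩ ⟨hp, hq⟩
  obtain ⟨hS, r, hr, h1, h2⟩ := exists_tilted_weight α hp hq
  have hkp := binary_pinsker hr hp
  have hkq := binary_pinsker hr hq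
  simp only [Set.mem_ofPred_eq]
  rw [← Real.log_le_iff_le_exp hS]
  rw [h1, h2] at hkp hkq
  have e1 := mul_le_mul_of_nonneg_left hkp hα.le
  have e2 := mul_le_mul_of_nonneg_left hkq (sub_nonneg.2 hα1.le)
  have e3 := sq_nonneg (r - α * p - (1 - α) * q)
  linarith

theorem exp_le_binaryRenyiSum {α p q : ℝ} (hα1 : 1 < α)
    (hp : p ∈ Set.Icc (0 : ℝ) 1) (hq : q ∈ Set.Ioo (0 : ℝ) 1) :
    Real.exp (2 * (α - 1) * (p - q) ^ 2) ≤ binaryRenyiSum α p q := by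
  have hα : 0 ≤ α := by linarith
  have hclosed : IsClosed {x : ℝ |
      Real.exp (2 * (α - 1) * (x - q) ^ 2) ≤ binaryRenyiSum α x q} := by
    refine isClosed_le (by fun_prop) ?_
    unfold binaryRenyiSum
    fun_prop (disch := assumption)
  have hmem : p ∈ closure (Set.Ioo (0 : ℝ) 1) := by rwa [closure_Ioo zero_ne_one]
  refine closure_minimal ?_ hclosed hmem
  intro p hp
  obtain ⟨hS, r, hr, h1, h2⟩ := exists_tilted_weight α hp hq
  have hkr := (mul_nonneg zero_le_two (sq_nonneg (p - r))).trans (binary_pinsker hp hr)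
  have hkq := binary_pinsker hp hq
  simp only [Set.mem_ofPred_eq]
  rw [← Real.le_log_iff_exp_le hS]
  rw [h1, h2] at hkr
  have e := mul_le_mul_of_nonneg_left hkq (sub_nonneg.2 hα1.le)
  linarith

/-- The Rényi–Pinsker inequality for two-point distributions. For `α < 1` the hypothesis
`hpos` excludes mutually singular distributions. -/
theorem le_renyiDivE_fin_two {α : ℝ} (hα : 0 < α) (hα1 : α ≠ 1) {p q : Fin 2 → ℝ}
    (hp : p 0 ∈ Set.Icc (0 : ℝ) 1) (hq : q 0 ∈ Set.Icc (0 : ℝ) 1)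
    (hp1 : p 1 = 1 - p 0) (hq1 : q 1 = 1 - q 0)
    (hpos : α < 1 → 0 < binaryRenyiSum α (p 0) (q 0)) :
    ((2 * min 1 α * (p 0 - q 0) ^ 2 : ℝ) : EReal) ≤ renyiDivE α p q := by
  unfold renyiDivE
  split_ifs with h
  · exact le_top
  rw [EReal.coe_le_coe_iff, Fin.sum_univ_two, hp1, hq1]
  change _ ≤ (α - 1)⁻¹ * Real.log (binaryRenyiSum α (p 0) (q 0))
  rcases hα1.lt_or_gt with hlt | hgt
  · have hS := hpos hlt
    have hlog := (Real.log_le_iff_le_exp hS).2 (binaryRenyiSum_le_exp hα hlt hp hq)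
    rw [min_eq_right hlt.le, inv_mul_eq_div, le_div_iff_of_neg (by linarith)]
    linarith
  · rw [min_eq_left hgt.le, inv_mul_eq_div, le_div_iff₀ (by linarith)]
    have hsupp : ∀ x, q x = 0 → p x ≤ 0 := fun x hx ↦ by
      by_contra! hpx
      exact h ⟨hgt, x, hpx, hx⟩
    have h0 : α ≠ 0 := hα.ne'
    rcases hq.1.eq_or_lt with hq0 | hq0
    · have : p 0 = 0 := le_antisymm (hsupp 0 hq0.symm) hp.1
      simp [binaryRenyiSum, this, ← hq0, h0]
    rcases hq.2.eq_or_lt with hq0' | hq0'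
    · have : p 0 = 1 := le_antisymm hp.2 (by linarith [hsupp 1 (by linarith)])
      simp [binaryRenyiSum, this, hq0', h0]
    have he := exp_le_binaryRenyiSum hgt hp ⟨hq0, hq0'⟩
    have := (Real.le_log_iff_exp_le ((Real.exp_pos _).trans_le he)).2 he
    linarith

theorem binaryRenyiSum_one_zero {α : ℝ} (hα : 0 < α) (hα1 : α < 1) :
    binaryRenyiSum α 1 0 = 0 := by
  have h : 1 - α ≠ 0 := by linarith
  simp [binaryRenyiSum, hα.ne', h]

/-- Two-point distributions with vanishing Rényi sum are mutually singular. -/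
theorem eq_one_and_eq_zero_of_binaryRenyiSum_nonpos {α p q : ℝ}
    (hp : p ∈ Set.Icc (0 : ℝ) 1) (hq : q ∈ Set.Icc (0 : ℝ) 1) (hqp : q ≤ p)
    (h : binaryRenyiSum α p q ≤ 0) : p = 1 ∧ q = 0 := by
  obtain ⟨hp0, hp1⟩ := hp
  obtain ⟨hq0, hq1⟩ := hq
  have hp1' : 0 ≤ 1 - p := by linarith
  have hq1' : 0 ≤ 1 - q := by linarith
  have ha : 0 ≤ p ^ α * q ^ (1 - α) := by positivity
  have hb : 0 ≤ (1 - p) ^ α * (1 - q) ^ (1 - α) := by positivity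
  unfold binaryRenyiSum at h
  have hq0' : q = 0 := by
    by_contra hne
    have hq' : 0 < q := lt_of_le_of_ne hq0 (Ne.symm hne)
    have hp' : 0 < p := hq'.trans_le hqp
    have : 0 < p ^ α * q ^ (1 - α) := by positivity
    linarith
  refine ⟨?_, hq0'⟩
  by_contra hne
  have hp' : 0 < 1 - p := sub_pos.2 (lt_of_le_of_ne hp1 hne)
  have hq' : 0 < 1 - q := by linarith
  have : 0 < (1 - p) ^ α * (1 - q) ^ (1 - α) := by positivity
  linarith

/-- The trace norm of a Hermitian matrix is the sum of the absolute values of its eigenvalues. -/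
theorem traceNorm_eq_sum_abs_eigenvalues {n : Type*} [Fintype n] [DecidableEq n]
    {A : Matrix n n ℂ} (hA : A.IsHermitian) : traceNorm A = ∑ i, |hA.eigenvalues i| := by
  have hB : (Aᴴ * A).IsHermitian := isHermitian_conjTranspose_mul_self A
  have hchar : (Aᴴ * A).charpoly =
      (diagonal fun i ↦ ((hA.eigenvalues i ^ 2 : ℝ) : ℂ)).charpoly := by
    have hU := Unitary.coe_star_mul_self hA.eigenvectorUnitary
    have h := hA.spectral_theorem
    rw [Unitary.conjStarAlgAut_apply] at h
    set U : Matrix n n ℂ := (hA.eigenvectorUnitary).1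
    set D : Matrix n n ℂ := diagonal (RCLike.ofReal ∘ hA.eigenvalues) with hD
    have hsq : Aᴴ * A = U * (D * D * star U) := by
      rw [hA.eq]
      calc A * A = U * D * star U * (U * D * star U) := by rw [← h]
        _ = U * D * (star U * U) * D * star U := by noncomm_ring
        _ = _ := by rw [hU]; noncomm_ring
    rw [hsq, charpoly_mul_comm, mul_assoc, hU, mul_one, hD, diagonal_mul_diagonal]
    congr 2
    ext i
    simp [sq]
  have hroots := hB.roots_charpoly_eq_eigenvalues
  rw [hchar, charpoly_diagonal, Polynomial.roots_prod _ _
    (Finset.prod_ne_zero_iff.2 fun i _ ↦ Polynomial.X_sub_C_ne_zero _)] at hroots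
  simp only [Polynomial.roots_X_sub_C, Multiset.bind_singleton] at hroots
  have hsum := congrArg (fun s ↦ (s.map fun z : ℂ ↦ √z.re).sum) hroots
  simp only [Multiset.map_map, Function.comp_def, Complex.ofReal_re,
    RCLike.ofReal_eq_complex_ofReal, Real.sqrt_sq_eq_abs] at hsum
  have hsum' : ∑ i, |hA.eigenvalues i| = ∑ i, √(hB.eigenvalues i) := hsum
  rw [hsum', traceNorm, mPow, dif_pos hB, trace_mul_comm, ← mul_assoc,
    Unitary.coe_star_mul_self, one_mul, trace_diagonal, Complex.re_sum]
  refine Finset.sum_congr rfl fun i _ ↦ ?_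
  rw [Complex.ofReal_re, Real.sqrt_eq_rpow]
  split_ifs with h <;> simp [h]

/-- For a traceless Hermitian matrix, the trace against the projection onto its positive part is
half of the trace norm. -/
theorem exists_projection_traceNorm {n : Type*} [Fintype n] [DecidableEq n]
    {A : Matrix n n ℂ} (hA : A.IsHermitian) (htr : A.trace = 0) :
    ∃ P : Matrix n n ℂ, P.IsHermitian ∧ P * P = P ∧ traceNorm A = 2 * (A * P).trace.re := by
  have hU := Unitary.coe_star_mul_self hA.eigenvectorUnitary
  have h := hA.spectral_theorem
  have htn := traceNorm_eq_sum_abs_eigenvalues hA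
  rw [Unitary.conjStarAlgAut_apply] at h
  set U : Matrix n n ℂ := (hA.eigenvectorUnitary).1
  set l := hA.eigenvalues
  set E : Matrix n n ℂ := diagonal fun i ↦ if 0 < l i then 1 else 0 with hE
  have hEE : E * E = E := by
    rw [hE, diagonal_mul_diagonal]
    congr 1
    ext i
    split_ifs <;> simp
  have hEH : Eᴴ = E := by
    rw [hE, diagonal_conjTranspose]
    congr 1
    ext i
    rw [Pi.star_apply]
    split_ifs
    exacts [star_one ℂ, star_zero ℂ]
  refine ⟨U * E * star U, ?_, ?_, ?_⟩
  · rw [IsHermitian, conjTranspose_mul, conjTranspose_mul, hEH, ← star_eq_conjTranspose,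
      ← star_eq_conjTranspose, star_star, mul_assoc]
  · calc U * E * star U * (U * E * star U) = U * E * (star U * U) * E * star U := by noncomm_ring
      _ = U * (E * E) * star U := by rw [hU]; noncomm_ring
      _ = _ := by rw [hEE]
  · have hAP : (A * (U * E * star U)).trace.re = ∑ i, if 0 < l i then l i else 0 := by
      have : A * (U * E * star U) = U * (diagonal (RCLike.ofReal ∘ l) * E * star U) := by
        calc A * (U * E * star U) =
            U * diagonal (RCLike.ofReal ∘ l) * star U * (U * E * star U) := by rw [← h]
          _ = U * diagonal (RCLike.ofReal ∘ l) * (star U * U) * E * star U := by noncomm_ring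
          _ = _ := by rw [hU]; noncomm_ring
      rw [this, trace_mul_comm, mul_assoc, hU, mul_one, hE, diagonal_mul_diagonal,
        trace_diagonal, Complex.re_sum]
      refine Finset.sum_congr rfl fun i _ ↦ ?_
      split_ifs <;> simp
    have hsum : ∑ i, l i = 0 := by
      have := hA.trace_eq_sum_eigenvalues
      rw [htr] at this
      exact Complex.ofReal_eq_zero.1 ((Complex.ofReal_sum _ _).trans this.symm)
    have hadd : ∑ i, |l i| + ∑ i, l i = 2 * ∑ i, if 0 < l i then l i else 0 := by
      rw [← Finset.sum_add_distrib, Finset.mul_sum]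
      refine Finset.sum_congr rfl fun i _ ↦ ?_
      split_ifs with hi
      · rw [abs_of_pos hi]; ring
      · rw [abs_of_nonpos (not_lt.1 hi)]; ring
    rw [htn, hAP, ← hadd, hsum, add_zero]

theorem trace_mul_projection_eq {n : Type*} [Fintype n] {P : Matrix n n ℂ} (ρ : Matrix n n ℂ)
    (hP : P.IsHermitian) (hPP : P * P = P) : (ρ * P).trace = (Pᴴ * ρ * P).trace := by
  rw [hP.eq, mul_assoc, trace_mul_comm P, mul_assoc, hPP]

theorem trace_mul_projection_mem_Icc {n : Type*} [Fintype n] [DecidableEq n]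
    {ρ P : Matrix n n ℂ} (hρ : ρ.PosSemidef) (hρ1 : ρ.trace = 1)
    (hP : P.IsHermitian) (hPP : P * P = P) : (ρ * P).trace.re ∈ Set.Icc (0 : ℝ) 1 := by
  have key : ∀ Q : Matrix n n ℂ, Q.IsHermitian → Q * Q = Q → 0 ≤ (ρ * Q).trace.re := by
    intro Q hQ hQQ
    rw [trace_mul_projection_eq ρ hQ hQQ]
    exact (Complex.le_def.1 (hρ.conjTranspose_mul_mul_same Q).trace_nonneg).1
  have h1 := key (1 - P) (isHermitian_one.sub hP) (by simp [sub_mul, mul_sub, hPP])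
  rw [mul_sub, mul_one, trace_sub, hρ1, Complex.sub_re, Complex.one_re] at h1
  exact ⟨key P hP hPP, by linarith⟩

theorem exists_smul_star_dotProduct_self_eq_one {n : Type*} [Fintype n] {x : n → ℂ}
    (hx : x ≠ 0) : ∃ c : ℂ, star (c • x) ⬝ᵥ (c • x) = 1 := by
  have hpos : 0 < star x ⬝ᵥ x := dotProduct_star_self_pos_iff.2 hx
  obtain ⟨hre, him⟩ := Complex.lt_def.1 hpos
  set t := star x ⬝ᵥ x
  have ht : t = (t.re : ℂ) := Complex.ext rfl (by simpa using him.symm)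
  refine ⟨((√t.re)⁻¹ : ℝ), ?_⟩
  rw [star_smul, smul_dotProduct, dotProduct_smul]
  change _ • _ • t = 1
  rw [ht]
  simp only [smul_eq_mul, RCLike.star_def, Complex.conj_ofReal, Complex.ofReal_re]
  norm_cast
  rw [← mul_assoc, ← mul_inv, Real.mul_self_sqrt (by simpa using hre.le),
    inv_mul_cancel₀ (by simpa using hre.ne')]

theorem isHermitian_vecMulVec_star {n : Type*} (w : n → ℂ) :
    (vecMulVec w (star w)).IsHermitian := by
  rw [IsHermitian, conjTranspose_vecMulVec, star_star]

theorem mul_eq_zero_of_trace_mul_projection_eq_zero {n : Type*} [Fintype n] [DecidableEq n]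
    {σ P : Matrix n n ℂ} (hσ : σ.PosSemidef) (hP : P.IsHermitian) (hPP : P * P = P)
    (h : (σ * P).trace.re = 0) : σ * P = 0 := by
  have hpsd := hσ.conjTranspose_mul_mul_same P
  have htr : (Pᴴ * σ * P).trace = 0 := by
    have := (Complex.le_def.1 hpsd.trace_nonneg).2
    refine Complex.ext ?_ this.symm
    rw [← trace_mul_projection_eq σ hP hPP, h, Complex.zero_re]
  have hzero := hpsd.trace_eq_zero_iff.1 htr
  refine Matrix.ext_of_mulVec_single fun i ↦ ?_
  rw [← mulVec_mulVec, zero_mulVec, ← hσ.dotProduct_mulVec_zero_iff, star_mulVec,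
    ← dotProduct_mulVec, mulVec_mulVec, mulVec_mulVec, hzero, zero_mulVec,
    dotProduct_zero]

/-- A projection `P ≠ 0` whose range lies in the kernel of a positive semidefinite `σ ≠ 0` can be
rotated continuously so that it no longer annihilates `σ`. -/
theorem exists_continuous_projection_rotation {n : Type*} [Fintype n] [DecidableEq n]
    {σ P : Matrix n n ℂ} (hσ : σ.PosSemidef) (hσ0 : σ ≠ 0) (hP : P.IsHermitian)
    (hPP : P * P = P) (hP0 : P ≠ 0) (hσP : σ * P = 0) :
    ∃ F : ℝ → Matrix n n ℂ, Continuous F ∧ F 0 = P ∧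
      (∀ s, (F s).IsHermitian ∧ F s * F s = F s) ∧
      ∀ s ∈ Set.Ioo 0 Real.pi, 0 < (σ * F s).trace.re := by
  obtain ⟨u, hu, hPu⟩ : ∃ u, star u ⬝ᵥ u = 1 ∧ P *ᵥ u = u := by
    obtain ⟨x, hx⟩ : ∃ x, P *ᵥ x ≠ 0 := by
      by_contra! h
      exact hP0 (Matrix.ext_of_mulVec_single fun i ↦ by rw [h, zero_mulVec])
    obtain ⟨c, hc⟩ := exists_smul_star_dotProduct_self_eq_one hx
    exact ⟨_, hc, by rw [mulVec_smul, mulVec_mulVec, hPP]⟩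
  obtain ⟨v, hv, hPv, hσv⟩ : ∃ v, star v ⬝ᵥ v = 1 ∧ P *ᵥ v = 0 ∧ σ *ᵥ v ≠ 0 := by
    obtain ⟨x, hx⟩ : ∃ x, σ *ᵥ x ≠ 0 := by
      by_contra! h
      exact hσ0 (Matrix.ext_of_mulVec_single fun i ↦ by rw [h, zero_mulVec])
    have hσy : σ *ᵥ (x - P *ᵥ x) ≠ 0 := by
      rwa [mulVec_sub, mulVec_mulVec, hσP, zero_mulVec, sub_zero]
    have hy : x - P *ᵥ x ≠ 0 := by
      intro h
      rw [h, mulVec_zero] at hσy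
      exact hσy rfl
    obtain ⟨c, hc⟩ := exists_smul_star_dotProduct_self_eq_one hy
    refine ⟨_, hc, ?_, ?_⟩
    · rw [mulVec_smul, mulVec_sub, mulVec_mulVec, hPP, sub_self, smul_zero]
    · rw [mulVec_smul]
      refine smul_ne_zero ?_ hσy
      rintro rfl
      simp at hc
  have huP : star u ᵥ* P = star u := by
    have := congrArg star hPu
    rwa [star_mulVec, hP.eq] at this
  have huv : star u ⬝ᵥ v = 0 := by
    rw [← huP, ← dotProduct_mulVec, hPv, dotProduct_zero]
  have hvu : star v ⬝ᵥ u = 0 := by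
    have := congrArg star huv
    rwa [star_dotProduct, star_star, star_zero, dotProduct_comm, dotProduct_comm] at this
  have hσu : σ *ᵥ u = 0 := by rw [← hPu, mulVec_mulVec, hσP, zero_mulVec]
  have hσv_pos : 0 < (star v ⬝ᵥ σ *ᵥ v).re := by
    have h0 := hσ.dotProduct_mulVec_nonneg v
    have hne : star v ⬝ᵥ σ *ᵥ v ≠ 0 := fun h ↦ hσv ((hσ.dotProduct_mulVec_zero_iff v).1 h)
    exact (Complex.lt_def.1 (lt_of_le_of_ne h0 hne.symm)).1
  let w : ℝ → n → ℂ := fun s ↦ (Real.cos s : ℂ) • u + (Real.sin s : ℂ) • v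
  have hstar : ∀ s, star (w s) = (Real.cos s : ℂ) • star u + (Real.sin s : ℂ) • star v := by
    intro s
    simp only [w, star_add, star_smul, RCLike.star_def, Complex.conj_ofReal]
  have hww : ∀ s, star (w s) ⬝ᵥ w s = 1 := by
    intro s
    rw [hstar]
    simp only [w, add_dotProduct, dotProduct_add, smul_dotProduct, dotProduct_smul, hu, hv, huv,
      hvu, smul_eq_mul]
    have := Real.cos_sq_add_sin_sq s
    have h' : (Real.cos s : ℂ) ^ 2 + (Real.sin s : ℂ) ^ 2 = 1 := by exact_mod_cast this
    linear_combination h'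
  have hPw : ∀ s, P *ᵥ w s = (Real.cos s : ℂ) • u := by
    intro s
    simp only [w, mulVec_add, mulVec_smul, hPu, hPv, smul_zero, add_zero]
  have huw : ∀ s, star u ⬝ᵥ w s = (Real.cos s : ℂ) := by
    intro s
    simp [w, dotProduct_add, dotProduct_smul, hu, huv]
  let Q : Matrix n n ℂ := P - vecMulVec u (star u)
  have hQ : Q.IsHermitian := hP.sub (isHermitian_vecMulVec_star u)
  have hQQ : Q * Q = Q := by
    simp only [Q, sub_mul, mul_sub, hPP, mul_vecMulVec, vecMulVec_mul, hPu, huP,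
      vecMulVec_mulVec, hu]
    simp
  have hQw : ∀ s, Q *ᵥ w s = 0 := by
    intro s
    rw [sub_mulVec, hPw, vecMulVec_mulVec, huw]
    simp
  have hwQ : ∀ s, star (w s) ᵥ* Q = 0 := by
    intro s
    have := congrArg star (hQw s)
    rwa [star_mulVec, hQ.eq, star_zero] at this
  refine ⟨fun s ↦ Q + vecMulVec (w s) (star (w s)), ?_, ?_, fun s ↦ ⟨?_, ?_⟩, ?_⟩
  · have hw : Continuous w := by fun_prop
    exact continuous_const.add (hw.matrix_vecMulVec hw.star)
  · simp [w, Q]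
  · exact hQ.add (isHermitian_vecMulVec_star _)
  · simp only [add_mul, mul_add, hQQ, mul_vecMulVec, vecMulVec_mul, hQw, hwQ,
      vecMulVec_mulVec, hww]
    simp
  · rintro s ⟨hs0, hs1⟩
    have hQσ : σ * Q = 0 := by
      rw [mul_sub, hσP, mul_vecMulVec, hσu, zero_vecMulVec, sub_zero]
    have hσw : σ *ᵥ w s = (Real.sin s : ℂ) • σ *ᵥ v := by
      simp only [w, mulVec_add, mulVec_smul, hσu, smul_zero, zero_add]
    have huσv : star u ⬝ᵥ σ *ᵥ v = 0 := by
      have := congrArg star hσu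
      rw [star_mulVec, hσ.1.eq, star_zero] at this
      rw [dotProduct_mulVec, this, zero_dotProduct]
    rw [mul_add, hQσ, zero_add, mul_vecMulVec, trace_vecMulVec, dotProduct_comm, hσw, hstar]
    simp only [add_dotProduct, smul_dotProduct, dotProduct_smul, huσv, mul_zero, zero_add,
      smul_eq_mul, Complex.re_ofReal_mul]
    have := Real.sin_pos_of_pos_of_lt_pi hs0 hs1
    positivity

/-- Lemma 5 (quantum Rényi-Pinsker inequality via a binary measurement): there is an
orthogonal projection `P` whose induced two-outcome distributions `p`, `q` satisfy
`D_α(p‖q) ≥ min{1,α}·‖ρ−σ‖₁²/2`. -/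
theorem exists_projection_renyi_pinsker {n : ℕ}
    (ρ σ : Matrix (Fin n) (Fin n) ℂ)
    (hρ : ρ.PosSemidef) (hσ : σ.PosSemidef)
    (hρ1 : Matrix.trace ρ = 1) (hσ1 : Matrix.trace σ = 1)
    (α : ℝ) (hα : 0 < α) (hα1 : α ≠ 1) :
    ∃ P : Matrix (Fin n) (Fin n) ℂ, P.IsHermitian ∧ P * P = P ∧
      ∀ p q : Fin 2 → ℝ,
        (p 0 = (Matrix.trace (ρ * P)).re ∧ p 1 = 1 - (Matrix.trace (ρ * P)).re) →
        (q 0 = (Matrix.trace (σ * P)).re ∧ q 1 = 1 - (Matrix.trace (σ * P)).re) →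
        ((min 1 α * traceNorm (ρ - σ) ^ 2 / 2 : ℝ) : EReal) ≤ renyiDivE α p q := by
  have htr : (ρ - σ).trace = 0 := by rw [trace_sub, hρ1, hσ1, sub_self]
  have hherm : (ρ - σ).IsHermitian := hρ.1.sub hσ.1
  obtain ⟨P, hP, hPP, htn⟩ := exists_projection_traceNorm hherm htr
  have htn0 : 0 ≤ traceNorm (ρ - σ) := by
    rw [traceNorm_eq_sum_abs_eigenvalues hherm]
    positivity
  rw [sub_mul, trace_sub, Complex.sub_re] at htn
  have hpP := trace_mul_projection_mem_Icc hρ hρ1 hP hPP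
  have hqP := trace_mul_projection_mem_Icc hσ hσ1 hP hPP
  by_cases hS : α < 1 → 0 < binaryRenyiSum α (ρ * P).trace.re (σ * P).trace.re
  · refine ⟨P, hP, hPP, fun p q ⟨hp0, hp1⟩ ⟨hq0, hq1⟩ ↦ ?_⟩
    rw [← hp0] at hpP hp1 hS htn
    rw [← hq0] at hqP hq1 hS htn
    convert le_renyiDivE_fin_two hα hα1 hpP hqP hp1 hq1 hS using 2
    rw [htn]
    ring
  push Not at hS
  obtain ⟨hlt, hS⟩ := hS
  obtain ⟨hp1, hq0⟩ :=
    eq_one_and_eq_zero_of_binaryRenyiSum_nonpos hpP hqP (by linarith) hS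
  have hσP := mul_eq_zero_of_trace_mul_projection_eq_zero hσ hP hPP hq0
  have hσ0 : σ ≠ 0 := by
    rintro rfl
    simp at hσ1
  have hP0 : P ≠ 0 := by
    rintro rfl
    simp at hp1
  obtain ⟨F, hFc, hF0, hF, hFpos⟩ :=
    exists_continuous_projection_rotation hσ hσ0 hP hPP hP0 hσP
  have hcont : ∀ τ : Matrix (Fin n) (Fin n) ℂ, Continuous fun s ↦ (τ * F s).trace.re :=
    fun τ ↦ Complex.continuous_re.comp (continuous_const.mul hFc).matrix_trace
  have hsum : ∀ᶠ s in nhds (0 : ℝ), binaryRenyiSum α (ρ * F s).trace.re (σ * F s).trace.re <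
      Real.exp (-(2 * α * (1 - α))) := by
    refine ((continuous_binaryRenyiSum hα hlt).comp
      ((hcont ρ).prodMk (hcont σ))).continuousAt.eventually_lt_const ?_
    simp only [Function.comp_apply, hF0, hp1, hq0, binaryRenyiSum_one_zero hα hlt]
    exact Real.exp_pos _
  have hppos : ∀ᶠ s in nhds (0 : ℝ), 0 < (ρ * F s).trace.re :=
    (hcont ρ).continuousAt.eventually_const_lt (by simp [hF0, hp1])
  have hIoo : ∀ᶠ s in nhdsWithin (0 : ℝ) (Set.Ioi 0), s ∈ Set.Ioo 0 Real.pi :=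
    Ioo_mem_nhdsGT Real.pi_pos
  obtain ⟨s, ⟨hs1, hs2⟩, hs3⟩ :=
    (((hsum.and hppos).filter_mono nhdsWithin_le_nhds).and hIoo).exists
  have hs4 := hFpos s hs3
  have hps := trace_mul_projection_mem_Icc hρ hρ1 (hF s).1 (hF s).2
  have hqs := trace_mul_projection_mem_Icc hσ hσ1 (hF s).1 (hF s).2
  refine ⟨F s, (hF s).1, (hF s).2, fun p q ⟨hp0', hp1'⟩ ⟨hq0', hq1'⟩ ↦ ?_⟩
  rw [← hp0'] at hs1 hs2 hps hp1'
  rw [← hq0'] at hs1 hs4 hqs hq1'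
  have hpos : 0 < binaryRenyiSum α (p 0) (q 0) := by
    have h1 : 0 ≤ 1 - p 0 := by linarith [hps.2]
    have h2 : 0 ≤ 1 - q 0 := by linarith [hqs.2]
    unfold binaryRenyiSum
    positivity
  rw [renyiDivE, if_neg fun h ↦ hlt.not_gt h.1, EReal.coe_le_coe_iff, Fin.sum_univ_two, hp1',
    hq1']
  change _ ≤ (α - 1)⁻¹ * Real.log (binaryRenyiSum α (p 0) (q 0))
  have hlog := (Real.log_le_iff_le_exp hpos).2 hs1.le
  rw [htn, hp1, hq0, min_eq_right hlt.le, inv_mul_eq_div, le_div_iff_of_neg (by linarith)]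
  linarith
end

section
/- Let σ be a positive definite Hermitian n×n matrix and ρ a positive semidefinite n×n matrix, and suppose the Hermitian matrix ω satisfies the Sylvester equation σω + ωσ = 2ρ. Then ω maximizes the functional f(ω') = 2·Tr[ρω'] − Tr[σω'²] over all Hermitian n×n matrices ω', i.e., f(ω') ≤ f(ω) for every Hermitian ω'. (Here Tr[ρω'] and Tr[σω'²] are real numbers since all matrices involved are Hermitian.) -/
open Matrix
open scoped ComplexOrder

/-- The solution `ω` of the Sylvester equation `σω + ωσ = 2ρ` maximizes the variational
objective `f(ω') = 2Tr[ρω'] − Tr[σω'²]` of the measured Rényi divergence of order 2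
over all Hermitian matrices `ω'`. -/
theorem sylvester_solution_maximizes_measured_renyi2_objective {n : ℕ}
    (σ ρ ω : Matrix (Fin n) (Fin n) ℂ)
    (hσ : σ.PosDef) (hρ : ρ.PosSemidef) (hω : ω.IsHermitian)
    (hSyl : σ * ω + ω * σ = 2 • ρ) :
    ∀ ω' : Matrix (Fin n) (Fin n) ℂ, ω'.IsHermitian →
      2 * (Matrix.trace (ρ * ω')).re - (Matrix.trace (σ * ω' ^ 2)).re ≤
        2 * (Matrix.trace (ρ * ω)).re - (Matrix.trace (σ * ω ^ 2)).re := by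
  intro ω' hω'
  have hSylTrace (X : Matrix (Fin n) (Fin n) ℂ) :
      2 * (ρ * X).trace = (σ * ω * X).trace + (σ * X * ω).trace := by
    have h := congrArg (fun M ↦ (M * X).trace) hSyl
    simp only [two_nsmul, add_mul, trace_add] at h
    rw [mul_assoc ω, trace_mul_comm ω] at h
    rw [two_mul, ← h]
  have hD : (ω' - ω)ᴴ = ω' - ω := (hω'.sub hω).eq
  have hnonneg : 0 ≤ ((ω' - ω) * σ * (ω' - ω)).trace := by
    simpa only [hD] using (hσ.posSemidef.conjTranspose_mul_mul_same (ω' - ω)).trace_nonneg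
  have hexpand : ((ω' - ω) * σ * (ω' - ω)).trace =
      (2 * (ρ * ω).trace - (σ * ω ^ 2).trace) -
        (2 * (ρ * ω').trace - (σ * ω' ^ 2).trace) := by
    rw [hSylTrace, hSylTrace, mul_assoc, trace_mul_comm]
    simp only [pow_two, mul_sub, sub_mul, trace_sub, mul_assoc]
    ring
  have hre := (Complex.le_def.mp (hexpand ▸ hnonneg)).1
  simp only [Complex.zero_re, Complex.sub_re, Complex.mul_re, Complex.re_ofNat,
    Complex.im_ofNat, zero_mul, sub_zero] at hre
  linarith
end

section
/- There exist finite nonempty types X, Y and a probability distribution p on X × Y with marginals p_X and p_Y such that the Rényi-2 mutual information defined through Rényi entropies is strictly negative: S₂(p_X) + S₂(p_Y) − S₂(p) < 0. -/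
/-- Rényi-2 entropy of a probability distribution: `S₂(P) = −log ∑_x P(x)²`. -/
noncomputable def renyi2Entropy {X : Type*} [Fintype X] (P : X → ℝ) : ℝ :=
  -Real.log (∑ x, P x ^ 2)

/-- There is a bipartite probability distribution whose Rényi-2 mutual information defined
through Rényi entropies, `S₂(p_X) + S₂(p_Y) − S₂(p)`, is strictly negative. -/
theorem exists_negative_renyi2_mutual_information :
    ∃ (m n : ℕ), 0 < m ∧ 0 < n ∧
      ∃ p : Fin m × Fin n → ℝ,
        (∀ z, 0 ≤ p z) ∧ (∑ z, p z = 1) ∧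
        renyi2Entropy (fun x => ∑ y, p (x, y)) + renyi2Entropy (fun y => ∑ x, p (x, y)) -
            renyi2Entropy p < 0 := by
  refine ⟨2, 2, two_pos, two_pos, fun z => !![3 / 5, 1 / 5; 1 / 5, 0] z.1 z.2, ?_, ?_, ?_⟩
  · rintro ⟨x, y⟩
    fin_cases x <;> fin_cases y <;> norm_num
  · norm_num [Fintype.sum_prod_type, Fin.sum_univ_two]
  · -- Both marginals are `(4/5, 1/5)`, so the claim is `11/25 < (17/25)²`.
    have hlog : Real.log (11 / 25) < Real.log (17 / 25) + Real.log (17 / 25) := by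
      rw [← Real.log_mul (by norm_num) (by norm_num)]
      exact Real.log_lt_log (by norm_num) (by norm_num)
    norm_num [renyi2Entropy, Fintype.sum_prod_type, Fin.sum_univ_two]
    linarith
end
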